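/- Let Γ be a conservative valued constraint language over a finite set D. Then Pol⁺(Γ) contains an idempotent cyclic operation if and only if Γ admits a conservative binary multimorphism ⟨⊓, ⊔⟩ and a conservative ternary multimorphism ⟨Mj₁, Mj₂, Mn₃⟩ together with a family M of two-element subsets of D such that: for every {x,y} ∈ M, ⟨⊓, ⊔⟩ restricted to {x,y} is an STP, and for every two-element {x,y} ∉ M, ⟨Mj₁, Mj₂, Mn₃⟩ restricted to {x,y} is an MJN. -/

import Mathlib

/-! Basic framework for Valued Constraint Satisfaction Problems (VCSP):
operations, clones, weightings, weighted clones, cost functions,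
(weighted/fractional) polymorphisms, expressibility and weighted relational clones. -/

/-- A `k`-ary operation on `D`. -/
abbrev Op (D : Type) (k : ℕ) : Type := (Fin k → D) → D

/-- The `i`-th `k`-ary projection on `D`. -/
def proj (D : Type) {k : ℕ} (i : Fin k) : Op D k := fun x => x i

/-- An operation is a projection. -/
def IsProj {D : Type} {k : ℕ} (f : Op D k) : Prop := ∃ i : Fin k, f = proj D i

/-- Superposition `f[g₁,…,g_k]` of a `k`-ary operation with `k` many `l`-ary operations. -/
def superposeOp {D : Type} {k l : ℕ} (f : Op D k) (g : Fin k → Op D l) : Op D l :=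
  fun x => f fun i => g i x

/-- A clone of operations on `D`: contains all projections and is closed under superposition. -/
structure IsClone {D : Type} (C : ∀ k, Set (Op D k)) : Prop where
  proj_mem : ∀ (k : ℕ) (i : Fin k), proj D i ∈ C k
  superpose_mem : ∀ (k l : ℕ) (f : Op D k) (g : Fin k → Op D l),
    f ∈ C k → (∀ i, g i ∈ C l) → superposeOp f g ∈ C l

/-- A `k`-ary weighting of the clone `C`: a rational-valued function on `k`-ary operations,
vanishing outside `C`, summing to `0`, and negative only on projections. -/
structure IsWeighting {D : Type} [Fintype D] [DecidableEq D] (C : ∀ k, Set (Op D k))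
    {k : ℕ} (ω : Op D k → ℚ) : Prop where
  support_mem : ∀ f : Op D k, ω f ≠ 0 → f ∈ C k
  sum_zero : ∑ f : Op D k, ω f = 0
  neg_imp_proj : ∀ f : Op D k, ω f < 0 → IsProj f

/-- Superposition of a `k`-ary weighting with `k` many `l`-ary operations. -/
def wSuperpose {D : Type} [Fintype D] [DecidableEq D] {k l : ℕ}
    (ω : Op D k → ℚ) (g : Fin k → Op D l) : Op D l → ℚ :=
  fun f' => ∑ f ∈ Finset.univ.filter (fun f : Op D k => superposeOp f g = f'), ω f

/-- A weighted clone over the clone `C`: a nonempty family of weightings of `C` closed under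
non-negative scaling, addition of weightings of equal arity and proper superposition. -/
structure IsWeightedClone {D : Type} [Fintype D] [DecidableEq D]
    (C : ∀ k, Set (Op D k)) (W : ∀ k, Set (Op D k → ℚ)) : Prop where
  clone : IsClone C
  weighting : ∀ (k : ℕ), ∀ ω ∈ W k, IsWeighting C ω
  nonempty : ∃ k, (W k).Nonempty
  scale_mem : ∀ (k : ℕ) (c : ℚ), 0 ≤ c → ∀ ω ∈ W k, (fun f => c * ω f) ∈ W k
  add_mem : ∀ (k : ℕ), ∀ ω₁ ∈ W k, ∀ ω₂ ∈ W k, (fun f => ω₁ f + ω₂ f) ∈ W k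
  superpose_mem : ∀ (k l : ℕ), ∀ ω ∈ W k, ∀ g : Fin k → Op D l,
    (∀ i, g i ∈ C l) → IsWeighting C (wSuperpose ω g) → wSuperpose ω g ∈ W l

/-- The positive clone of a family of weightings: all projections together with all operations
receiving positive weight from some weighting in the family. -/
def posClone {D : Type} [Fintype D] [DecidableEq D] (W : ∀ k, Set (Op D k → ℚ)) :
    ∀ k, Set (Op D k) :=
  fun k => {f | IsProj f ∨ ∃ ω ∈ W k, 0 < ω f}

/-- An `r`-ary cost function on `D`, with values in `ℚ ∪ {∞}`. -/
abbrev CostF (D : Type) (r : ℕ) : Type := (Fin r → D) → WithTop ℚ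

/-- The feasibility relation of a cost function. -/
def Feas {D : Type} {r : ℕ} (ϱ : CostF D r) : Set (Fin r → D) := {x | ϱ x ≠ ⊤}

/-- Coordinate-wise application of a `k`-ary operation to `k` many `r`-tuples. -/
def appRows {D : Type} {k r : ℕ} (f : Op D k) (xs : Fin k → Fin r → D) : Fin r → D :=
  fun j => f fun i => xs i j

/-- `f` is a polymorphism of `ϱ`: `Feas ϱ` is closed under coordinate-wise application of `f`. -/
def IsPolymorphism {D : Type} {k r : ℕ} (f : Op D k) (ϱ : CostF D r) : Prop :=
  ∀ xs : Fin k → Fin r → D, (∀ i, xs i ∈ Feas ϱ) → appRows f xs ∈ Feas ϱ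

/-- A valued constraint language on `D`: a set of cost functions of various arities. -/
abbrev VLang (D : Type) : Type := Set (Σ r : ℕ, CostF D r)

/-- The clone of polymorphisms of a language. -/
def Pol {D : Type} (Γ : VLang D) : ∀ k, Set (Op D k) :=
  fun _ => {f | ∀ ϱ ∈ Γ, IsPolymorphism f ϱ.2}

/-- Multiplication of an element of `ℚ ∪ {∞}` by a rational scalar (`c·∞ = ∞`). -/
def qmul (c : ℚ) (x : WithTop ℚ) : WithTop ℚ := WithTop.map (fun q => c * q) x

/-- The sum `∑_f ω(f)·ϱ(f(x₁,…,x_k))`, over operations with non-zero weight. -/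
def wSum {D : Type} [Fintype D] [DecidableEq D] {k r : ℕ}
    (ω : Op D k → ℚ) (ϱ : CostF D r) (xs : Fin k → Fin r → D) : WithTop ℚ :=
  ∑ f ∈ Finset.univ.filter (fun f : Op D k => ω f ≠ 0), qmul (ω f) (ϱ (appRows f xs))

/-- `ω` is a weighted polymorphism of the language `Γ`. -/
def IsWeightedPolymorphism {D : Type} [Fintype D] [DecidableEq D] (Γ : VLang D)
    {k : ℕ} (ω : Op D k → ℚ) : Prop :=
  IsWeighting (Pol Γ) ω ∧
    ∀ ϱ ∈ Γ, ∀ xs : Fin k → Fin ϱ.1 → D, (∀ i, xs i ∈ Feas ϱ.2) → wSum ω ϱ.2 xs ≤ 0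

/-- The weighted polymorphisms of a language. -/
def wPol {D : Type} [Fintype D] [DecidableEq D] (Γ : VLang D) :
    ∀ k, Set (Op D k → ℚ) :=
  fun _ => {ω | IsWeightedPolymorphism Γ ω}

/-- The positive clone `Pol⁺(Γ)` of a language. -/
def PolPlus {D : Type} [Fintype D] [DecidableEq D] (Γ : VLang D) : ∀ k, Set (Op D k) :=
  posClone (wPol Γ)

/-- The map `D → D` induced by a unary operation. -/
def unaryFun {D : Type} (f : Op D 1) : D → D := fun x => f fun _ => x

/-- A language is a core if every unary operation in its positive clone is bijective. -/
def IsCore {D : Type} [Fintype D] [DecidableEq D] (Γ : VLang D) : Prop :=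
  ∀ f ∈ PolPlus Γ 1, Function.Bijective (unaryFun f)

/-- An idempotent operation. -/
def Idem {D : Type} {k : ℕ} (f : Op D k) : Prop := ∀ x : D, (f fun _ => x) = x

/-- A cyclic operation: `f(x₁,…,x_k) = f(x₂,…,x_k,x₁)`. -/
def CyclicOp {D : Type} {k : ℕ} (f : Op D k) : Prop :=
  ∀ x : Fin k → D, f x = f (x ∘ ⇑(finRotate k))

/-- A conservative operation. -/
def Conservative {D : Type} {k : ℕ} (f : Op D k) : Prop :=
  ∀ x : Fin k → D, ∃ i, f x = x i

/-- A Taylor operation. -/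
def IsTaylor {D : Type} {k : ℕ} (t : Op D k) : Prop :=
  Idem t ∧ ∀ j : Fin k, ∃ a b : Fin k → Fin 2, a j = 0 ∧ b j = 1 ∧
    ∀ u : Fin 2 → D, (t fun i => u (a i)) = t fun i => u (b i)

/-- An instance of `VCSP(Γ)` with variable set `V`: a finite multiset of constraints,
each a tuple of variables together with a cost function from `Γ`. -/
structure VInstance (D : Type) (Γ : VLang D) (V : Type) where
  cons : Multiset (Σ r : ℕ, (Fin r → V) × CostF D r)
  mem_lang : ∀ c ∈ cons, (⟨c.1, c.2.2⟩ : Σ r : ℕ, CostF D r) ∈ Γ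

/-- The cost of an assignment for a VCSP instance. -/
def VInstance.cost {D V : Type} {Γ : VLang D} (I : VInstance D Γ V) (s : V → D) :
    WithTop ℚ :=
  (I.cons.map fun c => c.2.2 fun i => s (c.2.1 i)).sum

/-- A cost function is expressible over a language `Δ`. -/
def Expressible {D : Type} [Fintype D] [DecidableEq D] (Δ : VLang D) {r : ℕ}
    (ϱ : CostF D r) : Prop :=
  ∃ (n : ℕ) (I : VInstance D Δ (Fin n)) (v : Fin r → Fin n),
    ∀ x : Fin r → D,
      ϱ x = (Finset.univ.filter fun s : Fin n → D => ∀ i, s (v i) = x i).inf fun s => I.cost s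

/-- A language is closed under expressibility, non-negative scaling and
addition of rational constants. -/
def IsWClosed {D : Type} [Fintype D] [DecidableEq D] (Δ : VLang D) : Prop :=
  (∀ (r : ℕ) (ϱ : CostF D r), Expressible Δ ϱ → (⟨r, ϱ⟩ : Σ r : ℕ, CostF D r) ∈ Δ) ∧
  (∀ (r : ℕ) (ϱ : CostF D r) (c : ℚ), 0 ≤ c → (⟨r, ϱ⟩ : Σ r : ℕ, CostF D r) ∈ Δ →
    (⟨r, fun x => qmul c (ϱ x)⟩ : Σ r : ℕ, CostF D r) ∈ Δ) ∧
  (∀ (r : ℕ) (ϱ : CostF D r) (c : ℚ), (⟨r, ϱ⟩ : Σ r : ℕ, CostF D r) ∈ Δ →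
    (⟨r, fun x => ϱ x + (c : WithTop ℚ)⟩ : Σ r : ℕ, CostF D r) ∈ Δ)

/-- The weighted relational clone generated by `Γ`: the smallest language containing `Γ`
closed under expressibility, non-negative scaling and addition of rational constants. -/
def wRelClo {D : Type} [Fintype D] [DecidableEq D] (Γ : VLang D) : VLang D :=
  ⋂₀ {Δ : VLang D | Γ ⊆ Δ ∧ IsWClosed Δ}

/-- The weighting `(1/k)(∑_i 1_{f_i} − ∑_i 1_{π_i})` associated with a `k`-tuple of
`k`-ary operations (a multimorphism), weights added with multiplicity. -/
def multimorphismW {D : Type} [Fintype D] [DecidableEq D] {k : ℕ} (F : Fin k → Op D k) :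
    Op D k → ℚ :=
  fun g => (1 / (k : ℚ)) *
    (((Finset.univ.filter fun i : Fin k => F i = g).card : ℚ) -
     ((Finset.univ.filter fun i : Fin k => proj D i = g).card : ℚ))

/-- `Γ` admits the multimorphism `⟨F 0, …, F (k-1)⟩`. -/
def AdmitsMultimorphism {D : Type} [Fintype D] [DecidableEq D] {k : ℕ}
    (Γ : VLang D) (F : Fin k → Op D k) : Prop :=
  multimorphismW F ∈ wPol Γ k

/-- An `m`-ary fractional operation: a probability distribution on `m`-ary operations. -/
def IsFracOp {D : Type} [Fintype D] [DecidableEq D] {m : ℕ} (ω : Op D m → ℝ) : Prop :=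
  (∀ f, 0 ≤ ω f) ∧ ∑ f : Op D m, ω f = 1

/-- Multiplication of an element of `ℚ ∪ {∞}` by a real scalar, landing in `ℝ ∪ {∞}`. -/
def rmul (c : ℝ) (x : WithTop ℚ) : WithTop ℝ := WithTop.map (fun q : ℚ => c * (q : ℝ)) x

/-- `ω` is a fractional polymorphism of the language `Γ`. -/
def IsFracPolymorphism {D : Type} [Fintype D] [DecidableEq D] (Γ : VLang D) {m : ℕ}
    (ω : Op D m → ℝ) : Prop :=
  IsFracOp ω ∧ ∀ ϱ ∈ Γ, ∀ xs : Fin m → Fin ϱ.1 → D, (∀ i, xs i ∈ Feas ϱ.2) →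
    (∑ g ∈ Finset.univ.filter fun g : Op D m => 0 < ω g, rmul (ω g) (ϱ.2 (appRows g xs)))
      ≤ rmul (1 / (m : ℝ)) (∑ i : Fin m, ϱ.2 (xs i))

/-- The positive clone `fPol⁺(Γ)` defined via fractional polymorphisms. -/
def fPolPlus {D : Type} [Fintype D] [DecidableEq D] (Γ : VLang D) : ∀ k, Set (Op D k) :=
  fun k => {f | IsProj f ∨ ∃ ω : Op D k → ℝ, IsFracPolymorphism Γ ω ∧ 0 < ω f}

/-- Application of a binary operation to two elements. -/
def ap2 {D : Type} (f : Op D 2) (a b : D) : D := f ![a, b]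

/-- Application of a ternary operation to three elements. -/
def ap3 {D : Type} (f : Op D 3) (a b c : D) : D := f ![a, b, c]

/-- A ternary operation restricts to a majority operation on a subset `S`. -/
def IsMajorityOn {D : Type} (f : Op D 3) (S : Set D) : Prop :=
  ∀ x ∈ S, ∀ y ∈ S, ap3 f x x y = x ∧ ap3 f x y x = x ∧ ap3 f y x x = x

/-- A ternary operation restricts to a minority operation on a subset `S`. -/
def IsMinorityOn {D : Type} (f : Op D 3) (S : Set D) : Prop :=
  ∀ x ∈ S, ∀ y ∈ S, ap3 f x x y = y ∧ ap3 f x y x = y ∧ ap3 f y x x = y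

/-- The language `Γ_c`: `Γ` together with all unary cost functions `N_a`
(`N_a(a) = 0`, `N_a(x) = ∞` for `x ≠ a`). -/
def withConstants {D : Type} [DecidableEq D] (Γ : VLang D) : VLang D :=
  Γ ∪ {p : Σ r : ℕ, CostF D r |
        ∃ a : D, p = ⟨1, fun x => if x 0 = a then (0 : WithTop ℚ) else ⊤⟩}

/-- A language is conservative if it contains every `{0,1}`-valued unary cost function. -/
def ConservativeLang {D : Type} (Γ : VLang D) : Prop :=
  ∀ ϱ : CostF D 1, (∀ x, ϱ x = 0 ∨ ϱ x = 1) → (⟨1, ϱ⟩ : Σ r : ℕ, CostF D r) ∈ Γ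

/-- The coordinate-wise action of a `k`-ary operation on `A` on the power `A^n`. -/
def opPow {A : Type} (n : ℕ) {k : ℕ} (f : Op A k) : Op (Fin n → A) k :=
  fun xs c => f fun i => xs i c

/-- Regrouping an `(n·r)`-tuple over `A` into an `r`-tuple of elements of `A^n`. -/
def regroup (A : Type) (n r : ℕ) (y : Fin (n * r) → A) : Fin r → Fin n → A :=
  fun j c => y (finProdFinEquiv (c, j))
/-! ### Weightings of `Γ` in rational terms -/

/-- The finite part of a cost function (`0` on infeasible tuples). -/
def cost {D : Type} {r : ℕ} (ϱ : CostF D r) (x : Fin r → D) : ℚ := (ϱ x).untopD 0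

/-- A formal combination of polymorphisms with total weight zero which satisfies the
weighted polymorphism inequality; negative weights may sit on any polymorphism. -/
structure IsValid {D : Type} [Fintype D] [DecidableEq D] (Γ : VLang D) {k : ℕ}
    (ω : Op D k → ℚ) : Prop where
  support_mem : ∀ f : Op D k, ω f ≠ 0 → f ∈ Pol Γ k
  sum_zero : ∑ f : Op D k, ω f = 0
  sum_cost_le : ∀ ϱ ∈ Γ, ∀ xs : Fin k → Fin ϱ.1 → D, (∀ i, xs i ∈ Feas ϱ.2) →
    ∑ f : Op D k, ω f * cost ϱ.2 (appRows f xs) ≤ 0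

lemma coe_cost {D : Type} {r : ℕ} {ϱ : CostF D r} {x : Fin r → D} (h : x ∈ Feas ϱ) :
    ((cost ϱ x : ℚ) : WithTop ℚ) = ϱ x := by
  have h' : ϱ x ≠ ⊤ := h
  unfold cost
  lift ϱ x to ℚ using h' with q hq
  simp

lemma isClone_pol {D : Type} (Γ : VLang D) : IsClone (Pol Γ) where
  proj_mem _ i := fun _ _ _ hxs => hxs i
  superpose_mem _ _ _ g hf hg := fun ϱ hϱ xs hxs =>
    hf ϱ hϱ (fun i => appRows (g i) xs) fun i => hg i ϱ hϱ xs hxs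

section Weighted

variable {D : Type} [Fintype D] [DecidableEq D] {Γ : VLang D}

lemma wSum_eq {k : ℕ} {ω : Op D k → ℚ} (hω : ∀ f : Op D k, ω f ≠ 0 → f ∈ Pol Γ k)
    {ϱ : Σ r : ℕ, CostF D r} (hϱ : ϱ ∈ Γ) {xs : Fin k → Fin ϱ.1 → D}
    (hxs : ∀ i, xs i ∈ Feas ϱ.2) :
    wSum ω ϱ.2 xs = ((∑ f : Op D k, ω f * cost ϱ.2 (appRows f xs) : ℚ) : WithTop ℚ) := by
  have h1 : ∑ f : Op D k, ω f * cost ϱ.2 (appRows f xs) =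
      ∑ f ∈ Finset.univ.filter (fun f : Op D k => ω f ≠ 0),
        ω f * cost ϱ.2 (appRows f xs) := by
    rw [Finset.sum_filter]
    refine Finset.sum_congr rfl fun f _ => ?_
    split_ifs with h
    · rfl
    · simp [not_not.1 h]
  rw [h1, wSum, WithTop.coe_sum]
  refine Finset.sum_congr rfl fun f hf => ?_
  rw [← coe_cost (hω f (Finset.mem_filter.1 hf).2 ϱ hϱ xs hxs), qmul, WithTop.map_coe]

lemma mem_wPol_iff {k : ℕ} {ω : Op D k → ℚ} :
    ω ∈ wPol Γ k ↔ IsValid Γ ω ∧ ∀ f : Op D k, ω f < 0 → IsProj f := by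
  constructor
  · rintro ⟨h1, h2⟩
    refine ⟨⟨h1.support_mem, h1.sum_zero, fun ϱ hϱ xs hxs => ?_⟩, h1.neg_imp_proj⟩
    have := h2 ϱ hϱ xs hxs
    rw [wSum_eq h1.support_mem hϱ hxs] at this
    exact_mod_cast this
  · rintro ⟨h1, h2⟩
    refine ⟨⟨h1.support_mem, h1.sum_zero, h2⟩, fun ϱ hϱ xs hxs => ?_⟩
    rw [wSum_eq h1.support_mem hϱ hxs]
    exact_mod_cast h1.sum_cost_le ϱ hϱ xs hxs

lemma polPlus_subset_pol {k : ℕ} {f : Op D k} (hf : f ∈ PolPlus Γ k) : f ∈ Pol Γ k := by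
  rcases hf with ⟨i, rfl⟩ | ⟨ω, hω, hf⟩
  · exact (isClone_pol Γ).proj_mem k i
  · exact hω.1.support_mem f hf.ne'

lemma IsValid.zero {k : ℕ} : IsValid Γ (fun _ : Op D k => 0) :=
  ⟨fun _ h => absurd rfl h, by simp, fun _ _ _ _ => by simp⟩

lemma IsValid.smul {k : ℕ} {ω : Op D k → ℚ} (h : IsValid Γ ω) {c : ℚ} (hc : 0 ≤ c) :
    IsValid Γ (fun f => c * ω f) := by
  refine ⟨fun f hf => h.support_mem f (right_ne_zero_of_mul hf), ?_, fun ϱ hϱ xs hxs => ?_⟩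
  · rw [← Finset.mul_sum, h.sum_zero, mul_zero]
  · simp_rw [mul_assoc]
    rw [← Finset.mul_sum]
    exact mul_nonpos_of_nonneg_of_nonpos hc (h.sum_cost_le ϱ hϱ xs hxs)

lemma IsValid.add_sum {k : ℕ} {ι : Type} [Fintype ι] {ν : Op D k → ℚ} {η : ι → Op D k → ℚ}
    (hν : IsValid Γ ν) (hη : ∀ i, IsValid Γ (η i)) :
    IsValid Γ (fun f => ν f + ∑ i, η i f) := by
  refine ⟨fun f hf => ?_, ?_, fun ϱ hϱ xs hxs => ?_⟩
  · by_contra hp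
    apply hf
    have h1 : ν f = 0 := by
      by_contra h
      exact hp (hν.support_mem f h)
    have h2 : ∀ i, η i f = 0 := fun i => by
      by_contra h
      exact hp ((hη i).support_mem f h)
    simp [h1, h2]
  · rw [Finset.sum_add_distrib, Finset.sum_comm, hν.sum_zero]
    simp [fun i => (hη i).sum_zero]
  · simp_rw [add_mul, Finset.sum_mul]
    rw [Finset.sum_add_distrib, Finset.sum_comm]
    exact add_nonpos (hν.sum_cost_le ϱ hϱ xs hxs)
      (Finset.sum_nonpos fun i _ => (hη i).sum_cost_le ϱ hϱ xs hxs)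

/-- Negative weights on members of the positive clone can be compensated. -/
lemma IsValid.mem_polPlus {k : ℕ} {ν : Op D k → ℚ} (hν : IsValid Γ ν)
    (hneg : ∀ f, ν f < 0 → f ∈ PolPlus Γ k) {f : Op D k} (hf : 0 < ν f) :
    f ∈ PolPlus Γ k := by
  by_cases hfp : IsProj f
  · exact Or.inl hfp
  have key : ∀ h : Op D k, ∃ η : Op D k → ℚ, IsValid Γ η ∧ (∀ g, η g < 0 → IsProj g) ∧
      (¬ IsProj h → 0 ≤ ν h + η h) := by
    intro h
    by_cases hh : IsProj h
    · exact ⟨_, IsValid.zero, fun g hg => absurd hg (lt_irrefl _), fun h' => absurd hh h'⟩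
    · by_cases hn : ν h < 0
      · obtain ⟨ω, hω, hp⟩ := (hneg h hn).resolve_left hh
        obtain ⟨hv, hpr⟩ := mem_wPol_iff.1 hω
        have hc : 0 ≤ -ν h / ω h := div_nonneg (by linarith) hp.le
        refine ⟨_, hv.smul hc, fun g hg => hpr g ?_, fun _ => ?_⟩
        · by_contra hge
          exact absurd hg (not_lt.2 (mul_nonneg hc (not_lt.1 hge)))
        · rw [div_mul_cancel₀ _ hp.ne']
          simp
      · exact ⟨_, IsValid.zero, fun g hg => absurd hg (lt_irrefl _),
          fun _ => by simpa using hn⟩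
  choose η hη1 hη2 hη3 using key
  have hnn : ∀ g, ¬ IsProj g → ∀ h, 0 ≤ η h g := fun g hg h => by
    by_contra hlt
    exact hg (hη2 h g (not_le.1 hlt))
  refine Or.inr ⟨_, mem_wPol_iff.2 ⟨hν.add_sum hη1, fun g hg => ?_⟩, ?_⟩
  · by_contra hgp
    have h1 := hη3 g hgp
    have h2 : η g g ≤ ∑ h, η h g :=
      Finset.single_le_sum (f := fun h => η h g) (fun h _ => hnn g hgp h) (Finset.mem_univ g)
    linarith
  · have := Finset.sum_nonneg (s := Finset.univ) fun h _ => hnn f hfp h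
    linarith

lemma sum_wSuperpose_mul {k l : ℕ} (ω : Op D k → ℚ) (g : Fin k → Op D l) (a : Op D l → ℚ) :
    ∑ h, wSuperpose ω g h * a h = ∑ f, ω f * a (superposeOp f g) := by
  rw [← Finset.sum_fiberwise Finset.univ (fun f : Op D k => superposeOp f g)]
  refine Finset.sum_congr rfl fun h _ => ?_
  rw [wSuperpose, Finset.sum_mul]
  refine Finset.sum_congr rfl fun f hf => ?_
  rw [(Finset.mem_filter.1 hf).2]

lemma isClone_polPlus (Γ : VLang D) : IsClone (PolPlus Γ) where
  proj_mem _ i := Or.inl ⟨i, rfl⟩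
  superpose_mem k l f g hf hg := by
    by_cases hgi : ∃ i, superposeOp f g = g i
    · obtain ⟨i, hi⟩ := hgi
      rw [hi]
      exact hg i
    rcases hf with ⟨i, rfl⟩ | ⟨ω, hω, hf⟩
    · exact absurd ⟨i, rfl⟩ hgi
    obtain ⟨hv, hp⟩ := mem_wPol_iff.1 hω
    have hν : IsValid Γ (wSuperpose ω g) := by
      refine ⟨fun h hh => ?_, ?_, fun ϱ hϱ xs hxs => ?_⟩
      · obtain ⟨f', hf', hne⟩ := Finset.exists_ne_zero_of_sum_ne_zero hh
        rw [← (Finset.mem_filter.1 hf').2]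
        exact (isClone_pol Γ).superpose_mem _ _ _ _ (hv.support_mem f' hne)
          fun i => polPlus_subset_pol (hg i)
      · have := sum_wSuperpose_mul ω g fun _ => 1
        simpa [hv.sum_zero] using this
      · rw [sum_wSuperpose_mul ω g fun h => cost ϱ.2 (appRows h xs)]
        exact hv.sum_cost_le ϱ hϱ (fun i => appRows (g i) xs)
          fun i => polPlus_subset_pol (hg i) ϱ hϱ xs hxs
    refine hν.mem_polPlus (fun h hh => ?_) ?_
    · obtain ⟨f', hf', hneg⟩ := Finset.exists_lt_of_sum_lt
        (s := Finset.univ.filter fun f : Op D k => superposeOp f g = h)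
        (f := ω) (g := fun _ => 0) (by simpa [wSuperpose] using hh)
      obtain ⟨i, rfl⟩ := hp f' hneg
      rw [← (Finset.mem_filter.1 hf').2]
      exact hg i
    · refine Finset.sum_pos' (fun f' hf' => ?_) ⟨f, by simp, hf⟩
      by_contra hneg
      obtain ⟨i, rfl⟩ := hp f' (not_le.1 hneg)
      exact hgi ⟨i, (Finset.mem_filter.1 hf').2.symm⟩

lemma sum_unary_le {k : ℕ} {ω : Op D k → ℚ} (hcons : ConservativeLang Γ) (hω : IsValid Γ ω)
    (x : Fin k → D) (S : D → Prop) [DecidablePred S] :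
    ∑ f : Op D k, ω f * (if S (f x) then 1 else 0) ≤ 0 := by
  let u : CostF D 1 := fun y => if S (y 0) then 1 else 0
  have hu : (⟨1, u⟩ : Σ r : ℕ, CostF D r) ∈ Γ := hcons u fun y => by
    by_cases h : S (y 0) <;> simp [u, h]
  have hcost : ∀ y, cost u y = if S (y 0) then 1 else 0 := fun y => by
    by_cases h : S (y 0) <;> simp [u, cost, h]
  have := hω.sum_cost_le ⟨1, u⟩ hu (fun i _ => x i) fun i => by
    by_cases h : S (x i) <;> simp [u, Feas, h]
  simp only [hcost] at this
  exact this

lemma sum_ite_eq_zero {k : ℕ} {ω : Op D k → ℚ} (hcons : ConservativeLang Γ)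
    (hω : IsValid Γ ω) (x : Fin k → D) (a : D) :
    ∑ f : Op D k, ω f * (if f x = a then 1 else 0) = 0 := by
  have h1 := sum_unary_le hcons hω x fun b => b = a
  have h2 := sum_unary_le hcons hω x fun b => ¬ b = a
  have h3 : ∑ f : Op D k, ω f * (if f x = a then 1 else 0) +
      ∑ f : Op D k, ω f * (if ¬ f x = a then 1 else 0) = ∑ f : Op D k, ω f := by
    rw [← Finset.sum_add_distrib]
    refine Finset.sum_congr rfl fun f _ => ?_
    by_cases h : f x = a <;> simp [h]
  rw [hω.sum_zero] at h3
  linarith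

lemma conservative_of_mem_polPlus (hcons : ConservativeLang Γ) {k : ℕ} {f : Op D k}
    (hf : f ∈ PolPlus Γ k) : Conservative f := by
  intro x
  rcases hf with ⟨i, rfl⟩ | ⟨ω, hω, hf⟩
  · exact ⟨i, rfl⟩
  obtain ⟨hv, hp⟩ := mem_wPol_iff.1 hω
  by_contra hne
  have h1 := sum_unary_le hcons hv x fun b => ¬ ∃ i, b = x i
  refine absurd h1 (not_le.2 (Finset.sum_pos' (fun g _ => ?_) ⟨f, Finset.mem_univ f, ?_⟩))
  · by_cases hg : ω g < 0
    · obtain ⟨i, rfl⟩ := hp g hg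
      simp [proj]
    · exact mul_nonneg (not_lt.1 hg) (by split_ifs <;> simp)
  · rw [if_pos hne, mul_one]
    exact hf

/-! ### Multimorphisms -/

lemma sum_multimorphismW_mul {k : ℕ} (F : Fin k → Op D k) (a : Op D k → ℚ) :
    ∑ g, multimorphismW F g * a g =
      (1 / (k : ℚ)) * (∑ i, a (F i) - ∑ i : Fin k, a (proj D i)) := by
  have key : ∀ G : Fin k → Op D k,
      ∑ g, ((Finset.univ.filter fun i : Fin k => G i = g).card : ℚ) * a g = ∑ i, a (G i) := by
    intro G
    simp_rw [Finset.card_filter, Nat.cast_sum, Finset.sum_mul]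
    rw [Finset.sum_comm]
    simp
  rw [← key F, ← key, ← Finset.sum_sub_distrib, Finset.mul_sum]
  refine Finset.sum_congr rfl fun g _ => ?_
  rw [multimorphismW]
  ring

lemma admitsMultimorphism_of_cost_le {k : ℕ} {F : Fin k → Op D k} (hF : ∀ i, F i ∈ Pol Γ k)
    (h : ∀ ϱ ∈ Γ, ∀ xs : Fin k → Fin ϱ.1 → D, (∀ i, xs i ∈ Feas ϱ.2) →
      ∑ i, cost ϱ.2 (appRows (F i) xs) ≤ ∑ i, cost ϱ.2 (xs i)) :
    AdmitsMultimorphism Γ F := by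
  have hcard : ∀ (G : Fin k → Op D k) (g : Op D k), (∀ i, G i ≠ g) →
      (Finset.univ.filter fun i : Fin k => G i = g).card = 0 := fun G g hG =>
    Finset.card_eq_zero.2 (Finset.filter_eq_empty_iff.2 fun i _ => hG i)
  refine mem_wPol_iff.2 ⟨⟨fun g hg => ?_, ?_, fun ϱ hϱ xs hxs => ?_⟩, fun g hg => ?_⟩
  · by_contra hgp
    apply hg
    rw [multimorphismW, hcard F g fun i hi => hgp (hi ▸ hF i),
      hcard _ g fun i hi => hgp (hi ▸ (isClone_pol Γ).proj_mem k i)]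
    simp
  · have := sum_multimorphismW_mul F fun _ => 1
    simpa using this
  · rw [sum_multimorphismW_mul F fun g => cost ϱ.2 (appRows g xs)]
    refine mul_nonpos_of_nonneg_of_nonpos (by positivity) ?_
    have := h ϱ hϱ xs hxs
    have h2 : ∀ i : Fin k, appRows (proj D i) xs = xs i := fun i => rfl
    simp_rw [h2]
    linarith
  · by_contra hgp
    refine absurd hg (not_lt.2 ?_)
    rw [multimorphismW, hcard _ g fun i hi => hgp ⟨i, hi.symm⟩]
    simp only [Nat.cast_zero, sub_zero]
    positivity

lemma AdmitsMultimorphism.mem_polPlus {k : ℕ} {F : Fin k → Op D k}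
    (h : AdmitsMultimorphism Γ F) (i : Fin k) : F i ∈ PolPlus Γ k := by
  by_cases hp : IsProj (F i)
  · exact Or.inl hp
  refine Or.inr ⟨_, h, ?_⟩
  have h1 : (Finset.univ.filter fun j : Fin k => proj D j = F i).card = 0 :=
    Finset.card_eq_zero.2 (Finset.filter_eq_empty_iff.2 fun j _ hj => hp ⟨j, hj.symm⟩)
  have h2 : 0 < (Finset.univ.filter fun j : Fin k => F j = F i).card :=
    Finset.card_pos.2 ⟨i, by simp⟩
  have hk : 0 < k := i.pos
  rw [multimorphismW, h1]
  simp only [Nat.cast_zero, sub_zero]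
  positivity

end Weighted


/-! ### Conservative clones -/

/-- A clone all of whose operations are conservative. -/
structure IsConsClone {D : Type} (C : ∀ k, Set (Op D k)) : Prop extends IsClone C where
  conservative : ∀ (k : ℕ), ∀ f ∈ C k, Conservative f

/-- The (curried) binary operation `f` belongs to `C`. -/
def BinIn {D : Type} (C : ∀ k, Set (Op D k)) (f : D → D → D) : Prop :=
  (fun x : Fin 2 → D => f (x 0) (x 1)) ∈ C 2

/-- The (curried) ternary operation `f` belongs to `C`. -/
def TerIn {D : Type} (C : ∀ k, Set (Op D k)) (f : D → D → D → D) : Prop :=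
  (fun x : Fin 3 → D => f (x 0) (x 1) (x 2)) ∈ C 3

/-- Some binary operation of `C` is commutative on the two-element set `{a, b}`. -/
def CommPair {D : Type} (C : ∀ k, Set (Op D k)) (a b : D) : Prop :=
  a ≠ b ∧ ∃ f, BinIn C f ∧ f a b = f b a

/-- No binary operation of `C` is commutative on the two-element set `{a, b}`. -/
def ProjPair {D : Type} (C : ∀ k, Set (Op D k)) (a b : D) : Prop :=
  a ≠ b ∧ ∀ f, BinIn C f → f a b ≠ f b a

section ConsClone

variable {D : Type} {C : ∀ k, Set (Op D k)}

lemma IsClone.pr (hC : IsClone C) {k : ℕ} (i : Fin k) : (fun x : Fin k → D => x i) ∈ C k :=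
  hC.proj_mem k i

lemma IsClone.comp2 (hC : IsClone C) {k : ℕ} {f : D → D → D} {g h : Op D k}
    (hf : BinIn C f) (hg : g ∈ C k) (hh : h ∈ C k) : (fun x => f (g x) (h x)) ∈ C k :=
  hC.superpose_mem 2 k _ ![g, h] hf fun i => by
    fin_cases i
    exacts [hg, hh]

lemma IsClone.comp3 (hC : IsClone C) {k : ℕ} {f : D → D → D → D} {g h l : Op D k}
    (hf : TerIn C f) (hg : g ∈ C k) (hh : h ∈ C k) (hl : l ∈ C k) :
    (fun x => f (g x) (h x) (l x)) ∈ C k :=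
  hC.superpose_mem 3 k _ ![g, h, l] hf fun i => by
    fin_cases i
    exacts [hg, hh, hl]

lemma binIn_of_mem {f : Op D 2} (hf : f ∈ C 2) : BinIn C fun a b => f ![a, b] := by
  have : (fun x : Fin 2 → D => f ![x 0, x 1]) = f := by
    funext x
    congr 1
    ext i
    fin_cases i <;> rfl
  rw [BinIn, this]
  exact hf

lemma terIn_of_mem {f : Op D 3} (hf : f ∈ C 3) : TerIn C fun a b c => f ![a, b, c] := by
  have : (fun x : Fin 3 → D => f ![x 0, x 1, x 2]) = f := by
    funext x
    congr 1
    ext i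
    fin_cases i <;> rfl
  rw [TerIn, this]
  exact hf

lemma BinIn.eq_or (hC : IsConsClone C) {f : D → D → D} (hf : BinIn C f) (a b : D) :
    f a b = a ∨ f a b = b := by
  obtain ⟨i, hi⟩ := hC.conservative 2 _ hf ![a, b]
  fin_cases i
  exacts [Or.inl hi, Or.inr hi]

lemma TerIn.eq_or (hC : IsConsClone C) {f : D → D → D → D} (hf : TerIn C f) (a b c : D) :
    f a b c = a ∨ f a b c = b ∨ f a b c = c := by
  obtain ⟨i, hi⟩ := hC.conservative 3 _ hf ![a, b, c]
  fin_cases i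
  exacts [Or.inl hi, Or.inr (Or.inl hi), Or.inr (Or.inr hi)]

lemma BinIn.idem (hC : IsConsClone C) {f : D → D → D} (hf : BinIn C f) (a : D) :
    f a a = a := (or_self_iff).1 (hf.eq_or hC a a)

lemma CommPair.symm {a b : D} (h : CommPair C a b) : CommPair C b a :=
  ⟨h.1.symm, h.2.imp fun _ hf => ⟨hf.1, hf.2.symm⟩⟩

lemma ProjPair.symm {a b : D} (h : ProjPair C a b) : ProjPair C b a :=
  ⟨h.1.symm, fun f hf => (h.2 f hf).symm⟩

lemma commPair_or_projPair {a b : D} (h : a ≠ b) : CommPair C a b ∨ ProjPair C a b := by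
  by_cases hc : CommPair C a b
  · exact Or.inl hc
  · exact Or.inr ⟨h, fun f hf he => hc ⟨h, f, hf, he⟩⟩

lemma ProjPair.bin_cases (hC : IsConsClone C) {a b : D} (h : ProjPair C a b)
    {f : D → D → D} (hf : BinIn C f) :
    (f a b = a ∧ f b a = b) ∨ (f a b = b ∧ f b a = a) := by
  have h1 := hf.eq_or hC a b
  have h2 := hf.eq_or hC b a
  have h3 := h.2 f hf
  grind

variable [Finite D]

/-- A binary operation which is commutative wherever some operation of `C` is,
and acts as the first projection on the remaining pairs. -/
lemma exists_commutative_or_left (hC : IsConsClone C) :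
    ∃ s, BinIn C s ∧ (∀ a b, CommPair C a b → s a b = s b a) ∧
      ∀ a b, ProjPair C a b → s a b = a := by
  classical
  have := Fintype.ofFinite D
  have key : ∀ S : Finset (D × D), ∃ s, BinIn C s ∧
      ∀ e ∈ S, CommPair C e.1 e.2 → s e.1 e.2 = s e.2 e.1 := by
    intro S
    induction S using Finset.induction_on with
    | empty => exact ⟨fun a _ => a, hC.pr 0, by simp⟩
    | insert e S _ ih =>
      obtain ⟨s, hs, hS⟩ := ih
      by_cases he : CommPair C e.1 e.2
      · obtain ⟨-, f, hf, hfe⟩ := id he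
        refine ⟨fun x y => s (f x y) (f y x), hC.comp2 hs hf
          (hC.comp2 hf (hC.pr 1) (hC.pr 0)), fun e' he' hp => ?_⟩
        rcases Finset.mem_insert.1 he' with rfl | h
        · simp only [hfe]
        · have h1 := hS e' h hp
          have h2 := hf.eq_or hC e'.1 e'.2
          have h3 := hf.eq_or hC e'.2 e'.1
          have h4 := hs.idem hC
          grind
      · refine ⟨s, hs, fun e' he' hp => ?_⟩
        rcases Finset.mem_insert.1 he' with rfl | h
        · exact absurd hp he
        · exact hS e' h hp
  obtain ⟨s, hs, hS⟩ := key Finset.univ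
  have hS' : ∀ a b, CommPair C a b → s a b = s b a :=
    fun a b => hS (a, b) (Finset.mem_univ _)
  refine ⟨fun x y => s (s x y) (s y x), hC.comp2 hs hs
    (hC.comp2 hs (hC.pr 1) (hC.pr 0)), fun a b h => ?_, fun a b h => ?_⟩
  · simp only [hS' a b h]
  · rcases h.bin_cases hC hs with ⟨h1, h2⟩ | ⟨h1, h2⟩ <;> simp only [h1, h2]

end ConsClone

/-- The complement of a conservative binary operation: it returns the other argument. -/
def compl2 {D : Type} [DecidableEq D] (s : D → D → D) (a b : D) : D :=
  if s a b = a then b else a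

section Compl

variable {D : Type} [DecidableEq D] {s : D → D → D}

lemma compl2_cases (hs : ∀ a b, s a b = a ∨ s a b = b)
    (a b : D) :
    (s a b = a ∧ compl2 s a b = b) ∨ (s a b = b ∧ compl2 s a b = a) := by
  have h1 := hs a b
  unfold compl2
  grind

lemma compl2_left_step (hs : ∀ a b, s a b = a ∨ s a b = b)
    {a b q : D} (hq : q = a ∨ q = b) :
    s (s a q) b = s a b ∧ s a (compl2 s (s a q) b) = s a q ∧
      compl2 s a (compl2 s (s a q) b) = compl2 s a b := by
  have h0 := hs a a
  have h1 := hs a b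
  have h2 := hs b b
  unfold compl2
  rcases hq with rfl | rfl <;> grind

lemma compl2_left_step_diff (hs : ∀ a b, s a b = a ∨ s a b = b)
    {a b q : D} (hq : q = a ∨ q = b) :
    (a = b → s a q = b) ∧ (s a q ≠ a → a ≠ b ∧ s a q = b) ∧
      (a = b → a = compl2 s (s a q) b) ∧
      (s a q ≠ s a b → a ≠ b ∧ a = compl2 s (s a q) b) := by
  have h0 := hs a a
  have h1 := hs a b
  have h2 := hs b b
  unfold compl2
  rcases hq with rfl | rfl <;> grind

lemma compl2_right_step (hs : ∀ a b, s a b = a ∨ s a b = b)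
    {a b q : D} (hq : q = a ∨ q = b) :
    s a (s q b) = s a b ∧ s (compl2 s a (s q b)) b = s q b ∧
      compl2 s (compl2 s a (s q b)) b = compl2 s a b := by
  have h0 := hs a a
  have h1 := hs a b
  have h2 := hs b b
  unfold compl2
  rcases hq with rfl | rfl <;> grind

lemma compl2_right_step_diff (hs : ∀ a b, s a b = a ∨ s a b = b)
    {a b q : D} (hq : q = a ∨ q = b) :
    (a = b → a = s q b) ∧ (s q b ≠ b → a ≠ b ∧ a = s q b) ∧
      (a = b → compl2 s a (s q b) = b) ∧
      (s q b ≠ s a b → a ≠ b ∧ compl2 s a (s q b) = b) := by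
  have h0 := hs a a
  have h1 := hs a b
  have h2 := hs b b
  unfold compl2
  rcases hq with rfl | rfl <;> grind

lemma eq_corner_of_steps (hs : ∀ a b, s a b = a ∨ s a b = b)
    {a b q : D} (hq : q = a ∨ q = b) :
    (s a q = a → s q b = b → q = compl2 s a b) ∧ (s a q = a → s q b = s a b → q = a) ∧
      (s a q = s a b → s q b = b → q = b) ∧ (s a q = s a b → s q b = s a b → q = s a b) := by
  have h0 := hs a a
  have h1 := hs a b
  have h2 := hs b b
  unfold compl2
  rcases hq with rfl | rfl <;> grind

lemma card_filter_lt {r : ℕ} {x y x' y' : Fin r → D} (h : ∀ j, x j = y j → x' j = y' j)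
    (hs : ∃ j, x j ≠ y j ∧ x' j = y' j) :
    (Finset.univ.filter fun j => x' j ≠ y' j).card <
      (Finset.univ.filter fun j => x j ≠ y j).card := by
  obtain ⟨j, hj, hj'⟩ := hs
  refine Finset.card_lt_card (Finset.ssubset_iff_of_subset ?_ |>.2 ⟨j, by simpa, by simpa⟩)
  intro l hl
  simp only [Finset.mem_filter, Finset.mem_univ, true_and] at hl ⊢
  exact fun e => hl (h l e)

end Compl

section Exchange

variable {D : Type} [Fintype D] [DecidableEq D] {Γ : VLang D}

lemma isConsClone_polPlus (hcons : ConservativeLang Γ) : IsConsClone (PolPlus Γ) where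
  toIsClone := isClone_polPlus Γ
  conservative _ _ hf := conservative_of_mem_polPlus hcons hf

lemma BinIn.mem_feas {f : D → D → D} (hf : BinIn (PolPlus Γ) f) {ϱ : Σ r : ℕ, CostF D r}
    (hϱ : ϱ ∈ Γ) {x y : Fin ϱ.1 → D} (hx : x ∈ Feas ϱ.2) (hy : y ∈ Feas ϱ.2) :
    (fun j => f (x j) (y j)) ∈ Feas ϱ.2 :=
  polPlus_subset_pol hf ϱ hϱ ![x, y] fun i => by
    fin_cases i
    exacts [hx, hy]

lemma TerIn.mem_feas {f : D → D → D → D} (hf : TerIn (PolPlus Γ) f)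
    {ϱ : Σ r : ℕ, CostF D r} (hϱ : ϱ ∈ Γ) {x y z : Fin ϱ.1 → D} (hx : x ∈ Feas ϱ.2)
    (hy : y ∈ Feas ϱ.2) (hz : z ∈ Feas ϱ.2) :
    (fun j => f (x j) (y j) (z j)) ∈ Feas ϱ.2 :=
  polPlus_subset_pol hf ϱ hϱ ![x, y, z] fun i => by
    fin_cases i
    exacts [hx, hy, hz]

/-- If the rows `xs` only generate the four corners of a rectangle and the corner `e₁` is
generated but is not a row, then the opposite corner is feasible and the rectangle inequality
holds. -/
lemma rectangle_exchange (hcons : ConservativeLang Γ) {ϱ : Σ r : ℕ, CostF D r} (hϱ : ϱ ∈ Γ)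
    {k : ℕ} {xs : Fin k → Fin ϱ.1 → D} (hxs : ∀ l, xs l ∈ Feas ϱ.2)
    {e₁ e₂ e₃ e₄ : Fin ϱ.1 → D} {i j : Fin ϱ.1}
    (hi₂ : e₂ i = e₁ i) (hi₃ : e₃ i = e₄ i) (hi : e₁ i ≠ e₄ i)
    (hj₃ : e₃ j = e₁ j) (hj₂ : e₂ j = e₄ j) (hj : e₁ j ≠ e₄ j)
    (hcov : ∀ f ∈ PolPlus Γ k, appRows f xs = e₁ ∨ appRows f xs = e₂ ∨
      appRows f xs = e₃ ∨ appRows f xs = e₄)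
    {f₀ : Op D k} (hf₀ : f₀ ∈ PolPlus Γ k) (he : appRows f₀ xs = e₁)
    (hrow : ∀ l, xs l ≠ e₁) :
    e₄ ∈ Feas ϱ.2 ∧ cost ϱ.2 e₁ + cost ϱ.2 e₄ ≤ cost ϱ.2 e₂ + cost ϱ.2 e₃ := by
  have hnp : ∀ f : Op D k, appRows f xs = e₁ → ¬ IsProj f := by
    rintro _ hf ⟨l, rfl⟩
    exact hrow l hf
  obtain ⟨ω, hω, hp⟩ := hf₀.resolve_left (hnp f₀ he)
  obtain ⟨hv, hpr⟩ := mem_wPol_iff.1 hω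
  have hmem : ∀ f, ω f ≠ 0 → f ∈ PolPlus Γ k := fun f hf => by
    rcases lt_or_gt_of_ne hf with h | h
    · exact Or.inl (hpr f h)
    · exact Or.inr ⟨ω, hω, h⟩
  let W : (Fin ϱ.1 → D) → ℚ := fun e => ∑ f, ω f * if appRows f xs = e then 1 else 0
  have hsplit : ∀ a : (Fin ϱ.1 → D) → ℚ, ∑ f, ω f * a (appRows f xs) =
      W e₁ * a e₁ + W e₂ * a e₂ + W e₃ * a e₃ + W e₄ * a e₄ := by
    intro a
    simp only [W, Finset.sum_mul]
    rw [← Finset.sum_add_distrib, ← Finset.sum_add_distrib, ← Finset.sum_add_distrib]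
    refine Finset.sum_congr rfl fun f _ => ?_
    by_cases hf : ω f = 0
    · simp [hf]
    have h12 : e₁ ≠ e₂ := fun h => hj (by rw [← hj₂, h])
    have h13 : e₁ ≠ e₃ := fun h => hi (by rw [← hi₃, h])
    have h14 : e₁ ≠ e₄ := fun h => hi (by rw [h])
    have h23 : e₂ ≠ e₃ := fun h => hi (by rw [← hi₂, h, hi₃])
    have h24 : e₂ ≠ e₄ := fun h => hi (by rw [← hi₂, h])
    have h34 : e₃ ≠ e₄ := fun h => hj (by rw [← hj₃, h])
    rcases hcov f (hmem f hf) with h | h | h | h <;> rw [h] <;>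
      simp [h12, h13, h14, h23, h24, h34, h12.symm, h13.symm, h14.symm, h23.symm, h24.symm,
        h34.symm]
  have hW1 : W e₁ + W e₂ = 0 := by
    have h1 := hsplit fun x => if x i = e₁ i then 1 else 0
    have h2 := sum_ite_eq_zero hcons hv (fun l => xs l i) (e₁ i)
    have h3 : ∑ f, ω f * (if appRows f xs i = e₁ i then 1 else 0) = 0 := h2
    rw [h3] at h1
    simpa [hi₂, hi₃, hi.symm] using h1.symm
  have hW2 : W e₁ + W e₃ = 0 := by
    have h1 := hsplit fun x => if x j = e₁ j then 1 else 0
    have h2 := sum_ite_eq_zero hcons hv (fun l => xs l j) (e₁ j)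
    have h3 : ∑ f, ω f * (if appRows f xs j = e₁ j then 1 else 0) = 0 := h2
    rw [h3] at h1
    simpa [hj₂, hj₃, hj.symm] using h1.symm
  have hW3 : W e₁ + W e₂ + W e₃ + W e₄ = 0 := by
    have h1 := hsplit fun _ => 1
    simp only [mul_one] at h1
    rw [← h1, hv.sum_zero]
  have hpos : 0 < W e₁ := by
    refine Finset.sum_pos' (fun f _ => ?_) ⟨f₀, Finset.mem_univ _, by simp [he, hp]⟩
    by_cases h : appRows f xs = e₁
    · have : 0 ≤ ω f := not_lt.1 fun hlt => hnp f h (hpr f hlt)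
      simpa [h] using this
    · simp [h]
  constructor
  · have h4 : W e₄ ≠ 0 := by linarith
    obtain ⟨f, -, hf⟩ := Finset.exists_ne_zero_of_sum_ne_zero h4
    have hfe : appRows f xs = e₄ := by
      by_contra h
      simp [h] at hf
    rw [← hfe]
    exact hv.support_mem f (left_ne_zero_of_mul hf) ϱ hϱ xs hxs
  · have h1 := hv.sum_cost_le ϱ hϱ xs hxs
    rw [hsplit (cost ϱ.2)] at h1
    have h2 : W e₁ * (cost ϱ.2 e₁ + cost ϱ.2 e₄ - (cost ϱ.2 e₂ + cost ϱ.2 e₃)) ≤ 0 := by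
      have e2 : W e₂ = - W e₁ := by linarith
      have e3 : W e₃ = - W e₁ := by linarith
      have e4 : W e₄ = W e₁ := by linarith
      rw [e2, e3, e4] at h1
      linarith
    by_contra hlt
    exact absurd h2 (not_le.2 (mul_pos hpos (by linarith)))

/-- Every binary operation of the positive clone forms a multimorphism with its complement. -/
lemma cost_add_compl2_le (hcons : ConservativeLang Γ) {s : D → D → D}
    (hs : BinIn (PolPlus Γ) s) {ϱ : Σ r : ℕ, CostF D r} (hϱ : ϱ ∈ Γ) (x y : Fin ϱ.1 → D)
    (hx : x ∈ Feas ϱ.2) (hy : y ∈ Feas ϱ.2) :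
    (fun j => compl2 s (x j) (y j)) ∈ Feas ϱ.2 ∧
      cost ϱ.2 (fun j => s (x j) (y j)) + cost ϱ.2 (fun j => compl2 s (x j) (y j)) ≤
        cost ϱ.2 x + cost ϱ.2 y := by
  have hC := isConsClone_polPlus hcons
  have hs1 := hs.eq_or hC
  generalize hn : (Finset.univ.filter fun j => x j ≠ y j).card = n
  induction n using Nat.strong_induction_on generalizing x y with
  | _ n ih =>
  subst hn
  set v : Fin ϱ.1 → D := fun j => s (x j) (y j) with hv
  set w : Fin ϱ.1 → D := fun j => compl2 s (x j) (y j) with hw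
  have hvw : ∀ j, (v j = x j ∧ w j = y j) ∨ (v j = y j ∧ w j = x j) := fun j =>
    compl2_cases hs1 (x j) (y j)
  have hvF : v ∈ Feas ϱ.2 := hs.mem_feas hϱ hx hy
  by_cases hvx : v = x
  · have hwy : w = y := funext fun j => by
      rcases hvw j with h | h
      · exact h.2
      · rw [h.2, ← h.1, hvx]
    rw [hvx, hwy]
    exact ⟨hy, le_rfl⟩
  by_cases hvy : v = y
  · have hwx : w = x := funext fun j => by
      rcases hvw j with h | h
      · rw [h.2, ← h.1, hvy]
      · exact h.2
    rw [hvy, hwx]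
    exact ⟨hx, by linarith⟩
  by_cases hcov : ∀ f ∈ PolPlus Γ 2, appRows f ![x, y] = v ∨ appRows f ![x, y] = x ∨
      appRows f ![x, y] = y ∨ appRows f ![x, y] = w
  · obtain ⟨i, hi⟩ := Function.ne_iff.1 hvy
    obtain ⟨j, hj⟩ := Function.ne_iff.1 hvx
    obtain ⟨hvi, hwi⟩ := (hvw i).resolve_right fun h => hi h.1
    obtain ⟨hvj, hwj⟩ := (hvw j).resolve_left fun h => hj h.1
    refine rectangle_exchange hcons hϱ (xs := ![x, y]) (i := i) (j := j) (fun l => ?_)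
      hvi.symm hwi.symm (hwi.symm ▸ hi) hvj.symm hwj.symm (hwj.symm ▸ hj)
      hcov (f₀ := fun x => s (x 0) (x 1)) hs rfl fun l => ?_
    · fin_cases l
      exacts [hx, hy]
    · fin_cases l
      exacts [Ne.symm hvx, Ne.symm hvy]
  push Not at hcov
  obtain ⟨f, hf, hqv, hqx, hqy, hqw⟩ := hcov
  have hf' := binIn_of_mem hf
  set q : Fin ϱ.1 → D := fun j => f ![x j, y j] with hq
  have hqe : appRows f ![x, y] = q := funext fun j => by
    simp only [appRows, hq]
    congr 1
    ext i
    fin_cases i <;> rfl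
  rw [hqe] at hqv hqx hqy hqw
  have hqF : q ∈ Feas ϱ.2 := hf'.mem_feas hϱ hx hy
  have hq1 : ∀ j, q j = x j ∨ q j = y j := fun j => hf'.eq_or hC (x j) (y j)
  by_cases hA : (fun j => s (x j) (q j)) ≠ x ∧ (fun j => s (x j) (q j)) ≠ v
  · obtain ⟨hA1, hA2⟩ := hA
    have hzF : (fun j => s (x j) (q j)) ∈ Feas ϱ.2 := hs.mem_feas hϱ hx hqF
    set z : Fin ϱ.1 → D := fun j => s (x j) (q j) with hz
    obtain ⟨i, hi⟩ := Function.ne_iff.1 hA1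
    obtain ⟨j, hj⟩ := Function.ne_iff.1 hA2
    have hstep := fun j => compl2_left_step hs1 (hq1 j)
    have hdiff := fun j => compl2_left_step_diff hs1 (hq1 j)
    have e1 : (fun j => s (z j) (y j)) = v := funext fun j => (hstep j).1
    have e2 : (fun j => s (x j) (compl2 s (z j) (y j))) = z := funext fun j => (hstep j).2.1
    have e3 : (fun j => compl2 s (x j) (compl2 s (z j) (y j))) = w :=
      funext fun j => (hstep j).2.2
    obtain ⟨h1, h2⟩ := ih _ (card_filter_lt (fun j => (hdiff j).1)
      ⟨i, (hdiff i).2.1 hi⟩) z y hzF hy rfl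
    obtain ⟨h3, h4⟩ := ih _ (card_filter_lt (fun j => (hdiff j).2.2.1)
      ⟨j, (hdiff j).2.2.2 hj⟩) x (fun j => compl2 s (z j) (y j)) hx h1 rfl
    rw [e1] at h2
    rw [e2, e3] at h4
    rw [e3] at h3
    exact ⟨h3, by linarith⟩
  by_cases hB : (fun j => s (q j) (y j)) ≠ y ∧ (fun j => s (q j) (y j)) ≠ v
  · obtain ⟨hB1, hB2⟩ := hB
    have hzF : (fun j => s (q j) (y j)) ∈ Feas ϱ.2 := hs.mem_feas hϱ hqF hy
    set z : Fin ϱ.1 → D := fun j => s (q j) (y j) with hz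
    obtain ⟨i, hi⟩ := Function.ne_iff.1 hB1
    obtain ⟨j, hj⟩ := Function.ne_iff.1 hB2
    have hstep := fun j => compl2_right_step hs1 (hq1 j)
    have hdiff := fun j => compl2_right_step_diff hs1 (hq1 j)
    have e1 : (fun j => s (x j) (z j)) = v := funext fun j => (hstep j).1
    have e2 : (fun j => s (compl2 s (x j) (z j)) (y j)) = z := funext fun j => (hstep j).2.1
    have e3 : (fun j => compl2 s (compl2 s (x j) (z j)) (y j)) = w :=
      funext fun j => (hstep j).2.2
    obtain ⟨h1, h2⟩ := ih _ (card_filter_lt (fun j => (hdiff j).1)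
      ⟨i, (hdiff i).2.1 hi⟩) x z hx hzF rfl
    obtain ⟨h3, h4⟩ := ih _ (card_filter_lt (fun j => (hdiff j).2.2.1)
      ⟨j, (hdiff j).2.2.2 hj⟩) (fun j => compl2 s (x j) (z j)) y h1 hy rfl
    rw [e1] at h2
    rw [e2, e3] at h4
    rw [e3] at h3
    exact ⟨h3, by linarith⟩
  exfalso
  have hcor := fun j => eq_corner_of_steps hs1 (hq1 j)
  rw [not_and_or, not_not, not_not] at hA hB
  rcases hA with hA | hA <;> rcases hB with hB | hB
  · exact hqw (funext fun j => (hcor j).1 (congrFun hA j) (congrFun hB j))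
  · exact hqx (funext fun j => (hcor j).2.1 (congrFun hA j) (congrFun hB j))
  · exact hqy (funext fun j => (hcor j).2.2.1 (congrFun hA j) (congrFun hB j))
  · exact hqv (funext fun j => (hcor j).2.2.2 (congrFun hA j) (congrFun hB j))

lemma binIn_compl2 (hcons : ConservativeLang Γ) {s : D → D → D}
    (hs : BinIn (PolPlus Γ) s) :
    BinIn (PolPlus Γ) (compl2 s) ∧ AdmitsMultimorphism Γ
      ![fun x : Fin 2 → D => s (x 0) (x 1), fun x => compl2 s (x 0) (x 1)] := by
  have h : AdmitsMultimorphism Γ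
      ![fun x : Fin 2 → D => s (x 0) (x 1), fun x => compl2 s (x 0) (x 1)] := by
    refine admitsMultimorphism_of_cost_le (fun i => ?_) fun ϱ hϱ xs hxs => ?_
    · fin_cases i
      · exact polPlus_subset_pol hs
      · exact fun ϱ hϱ xs hxs =>
          (cost_add_compl2_le hcons hs hϱ (xs 0) (xs 1) (hxs 0) (hxs 1)).1
    · rw [Fin.sum_univ_two, Fin.sum_univ_two]
      exact (cost_add_compl2_le hcons hs hϱ (xs 0) (xs 1) (hxs 0) (hxs 1)).2
  exact ⟨h.mem_polPlus 1, h⟩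

end Exchange

/-- `d` is the first projection on commutative pairs and the second one on projection pairs,
while `p` is a Pixley operation on projection pairs. -/
structure IsToolkit {D : Type} (C : ∀ k, Set (Op D k)) (d : D → D → D)
    (p : D → D → D → D) : Prop where
  bin : BinIn C d
  ter : TerIn C p
  comm : ∀ {a b}, CommPair C a b → d a b = a
  proj : ∀ {a b}, ProjPair C a b → d a b = b
  aab : ∀ {a b}, ProjPair C a b → p a a b = b
  aba : ∀ {a b}, ProjPair C a b → p a b a = a
  abb : ∀ {a b}, ProjPair C a b → p a b b = a

/-- The majority term of a Pixley operation. -/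
def pixMaj {D : Type} (p : D → D → D → D) (x y z : D) : D := p x (p x y z) z

/-- A term which avoids the middle argument on triples of projection pairs. -/
def pixEnds {D : Type} (p : D → D → D → D) (x y z : D) : D :=
  pixMaj p x (pixMaj p z (p y (p x y z) z) x) z

/-- First term of the exchange step. -/
def stepFst {D : Type} (d : D → D → D) (p : D → D → D → D) (x y z : D) : D :=
  pixEnds p x (d (d x z) (d x y)) (d x z)

/-- Second term of the exchange step. -/
def stepSnd {D : Type} (d : D → D → D) (p : D → D → D → D) (x y z : D) : D :=
  d z (p x (stepFst d p x y z) (d x z))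

section Toolkit

variable {D : Type} {C : ∀ k, Set (Op D k)} {d : D → D → D} {p : D → D → D → D}

lemma IsToolkit.p_idem (h : IsToolkit C d p) (hC : IsConsClone C) (a : D) : p a a a = a := by
  have := h.ter.eq_or hC a a a
  grind

lemma terIn_pixMaj (hC : IsClone C) (hp : TerIn C p) : TerIn C (pixMaj p) := by
  unfold TerIn pixMaj
  exact hC.comp3 hp (hC.pr 0) hp (hC.pr 2)

lemma terIn_pixEnds (hC : IsClone C) (hp : TerIn C p) : TerIn C (pixEnds p) := by
  have hm := terIn_pixMaj hC hp
  unfold TerIn pixEnds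
  exact hC.comp3 hm (hC.pr 0) (hC.comp3 hm (hC.pr 2) (hC.comp3 hp (hC.pr 1) hp (hC.pr 2)) (hC.pr 0))
    (hC.pr 2)

lemma terIn_stepFst (hC : IsClone C) (hd : BinIn C d) (hp : TerIn C p) :
    TerIn C (stepFst d p) := by
  have hxz := hC.comp2 hd (hC.pr (k := 3) 0) (hC.pr 2)
  unfold TerIn stepFst
  exact hC.comp3 (terIn_pixEnds hC hp) (hC.pr 0)
    (hC.comp2 hd hxz (hC.comp2 hd (hC.pr 0) (hC.pr 1))) hxz

lemma terIn_stepSnd (hC : IsClone C) (hd : BinIn C d) (hp : TerIn C p) :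
    TerIn C (stepSnd d p) :=
  hC.comp2 hd (hC.pr 2) (hC.comp3 hp (hC.pr 0) (terIn_stepFst hC hd hp)
    (hC.comp2 hd (hC.pr 0) (hC.pr 2)))

lemma IsToolkit.maj_aab (h : IsToolkit C d p) {a b : D} (hab : ProjPair C a b) :
    pixMaj p a a b = a := by
  rw [pixMaj, h.aab hab, h.abb hab]

lemma IsToolkit.maj_aba (h : IsToolkit C d p) (hC : IsConsClone C) {a b : D}
    (hab : ProjPair C a b) : pixMaj p a b a = a := by
  rw [pixMaj, h.aba hab, h.p_idem hC]

lemma IsToolkit.maj_baa (h : IsToolkit C d p) {a b : D} (hab : ProjPair C a b) :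
    pixMaj p b a a = a := by
  rw [pixMaj, h.abb hab.symm, h.aab hab.symm]

lemma IsToolkit.maj_idem (h : IsToolkit C d p) (hC : IsConsClone C) (a : D) :
    pixMaj p a a a = a := by
  rw [pixMaj, h.p_idem hC, h.p_idem hC]

lemma IsToolkit.ends_aab (h : IsToolkit C d p) {a b : D} (hab : ProjPair C a b) :
    pixEnds p a a b = a := by
  rw [pixEnds, h.aab hab, h.abb hab, h.maj_baa hab, h.maj_aab hab]

lemma IsToolkit.ends_abb (h : IsToolkit C d p) {a b : D}
    (hab : ProjPair C a b) : pixEnds p a b b = b := by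
  rw [pixEnds, h.abb hab, h.aba hab.symm, h.maj_aab hab.symm, h.maj_baa hab.symm]

lemma IsToolkit.ends_aba (h : IsToolkit C d p) (hC : IsConsClone C) {a b : D}
    (hab : ProjPair C a b) : pixEnds p a b a = a := by
  rw [pixEnds, h.aba hab, h.abb hab.symm, h.maj_aba hC hab, h.maj_idem hC]

lemma IsToolkit.ends_abc (h : IsToolkit C d p) (hC : IsConsClone C) {a b c : D}
    (hac : ProjPair C a c) (hbc : ProjPair C b c) :
    pixEnds p a b c = a ∨ pixEnds p a b c = c := by
  rw [pixEnds]
  rcases h.ter.eq_or hC a b c with e | e | e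
  · have hm : pixMaj p a b c = c := by rw [pixMaj, e, h.aab hac]
    rw [e]
    rcases (terIn_pixMaj hC.toIsClone h.ter).eq_or hC c (p b a c) a with e' | e' | e'
    · rw [e', h.maj_baa hac.symm]
      exact Or.inr rfl
    · rw [e']
      rcases h.ter.eq_or hC b a c with e'' | e'' | e'' <;> rw [e'']
      · exact Or.inr hm
      · exact Or.inl (h.maj_aab hac)
      · exact Or.inr (h.maj_baa hac.symm)
    · rw [e']
      exact Or.inl (h.maj_aab hac)
  · rw [e, h.aab hbc, h.maj_aab hac.symm, h.maj_baa hac.symm]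
    exact Or.inr rfl
  · have hm : pixMaj p a b c = a := by rw [pixMaj, e, h.abb hac]
    rw [e]
    rcases (terIn_pixMaj hC.toIsClone h.ter).eq_or hC c (p b c c) a with e' | e' | e'
    · rw [e']
      exact Or.inr (h.maj_baa hac.symm)
    · rw [e', h.abb hbc]
      exact Or.inl hm
    · rw [e']
      exact Or.inl (h.maj_aab hac)

lemma IsToolkit.d_idem (h : IsToolkit C d p) (hC : IsConsClone C) (a : D) : d a a = a :=
  h.bin.idem hC a

lemma IsToolkit.step_of_d_eq (h : IsToolkit C d p) (hC : IsConsClone C) {x z : D}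
    (hxz : d x z = x) (hzx : d z x = z) (y : D) :
    stepFst d p x y z = x ∧ stepSnd d p x y z = z := by
  have h1 : stepFst d p x y z = x := by
    rw [stepFst, hxz]
    by_cases hxy : x = y
    · subst hxy
      rw [h.d_idem hC, h.d_idem hC, pixEnds, h.p_idem hC, h.p_idem hC, h.maj_idem hC,
        h.maj_idem hC]
    · rcases commPair_or_projPair (C := C) hxy with hc | hc
      · rw [h.comm hc, h.d_idem hC, pixEnds, h.p_idem hC, h.p_idem hC, h.maj_idem hC,
          h.maj_idem hC]
      · rw [h.proj hc, h.proj hc, h.ends_aba hC hc]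
  refine ⟨h1, ?_⟩
  rw [stepSnd, h1, hxz, h.p_idem hC, hzx]

lemma IsToolkit.step_of_projPair (h : IsToolkit C d p) (hC : IsConsClone C) {x z : D}
    (hxz : ProjPair C x z) (y : D) :
    (stepFst d p x y z = x ∧ stepSnd d p x y z = z) ∨
      (stepFst d p x y z = z ∧ stepSnd d p x y z = x) := by
  have h1 : stepFst d p x y z = x ∨ stepFst d p x y z = z := by
    rw [stepFst, h.proj hxz]
    have hx : d z x = x := h.proj hxz.symm
    by_cases hxy : x = y
    · subst hxy
      rw [h.d_idem hC, hx, h.ends_aab hxz]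
      exact Or.inl rfl
    rcases commPair_or_projPair (C := C) hxy with hc | hc
    · rw [h.comm hc, hx, h.ends_aab hxz]
      exact Or.inl rfl
    rw [h.proj hc]
    by_cases hyz : z = y
    · subst hyz
      rw [h.d_idem hC, h.ends_abb hxz]
      exact Or.inr rfl
    rcases commPair_or_projPair (C := C) hyz with hc' | hc'
    · rw [h.comm hc', h.ends_abb hxz]
      exact Or.inr rfl
    · rw [h.proj hc']
      exact h.ends_abc hC hxz hc'.symm
  rcases h1 with e | e
  · refine Or.inl ⟨e, ?_⟩
    rw [stepSnd, e, h.proj hxz, h.aab hxz, h.d_idem hC]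
  · refine Or.inr ⟨e, ?_⟩
    rw [stepSnd, e, h.proj hxz, h.abb hxz, h.proj hxz.symm]

lemma IsToolkit.step_aab (h : IsToolkit C d p) (hC : IsConsClone C) {a b : D}
    (hab : ProjPair C a b) : stepFst d p a a b = a ∧ stepSnd d p a a b = b := by
  have e : stepFst d p a a b = a := by
    rw [stepFst, h.proj hab, h.d_idem hC, h.proj hab.symm, h.ends_aab hab]
  have := h.step_of_projPair hC hab a
  have := hab.1
  grind

lemma IsToolkit.step_abb (h : IsToolkit C d p) (hC : IsConsClone C) {a b : D}
    (hab : ProjPair C a b) : stepFst d p a b b = b ∧ stepSnd d p a b b = a := by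
  have e : stepFst d p a b b = b := by
    rw [stepFst, h.proj hab, h.d_idem hC, h.ends_abb hab]
  have := h.step_of_projPair hC hab b
  have := hab.1
  grind

lemma IsToolkit.step_aba (h : IsToolkit C d p) (hC : IsConsClone C) (a b : D) :
    stepFst d p a b a = a ∧ stepSnd d p a b a = a :=
  h.step_of_d_eq hC (h.d_idem hC a) (h.d_idem hC a) b

/-- Scalar identities behind one exchange step. -/
lemma IsToolkit.step_identities [DecidableEq D] (h : IsToolkit C d p) (hC : IsConsClone C)
    (x y z : D) :
    (stepFst d p x y z = x ∨ stepFst d p x y z = d x z) ∧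
      (x ≠ d x z → ProjPair C x (d x z)) ∧
      p x (stepFst d p x y z) (d x z) = d (stepFst d p x y z) (stepSnd d p x y z) ∧
      d (d (stepFst d p x y z) (stepSnd d p x y z)) z = d x z ∧
      compl2 d (d (stepFst d p x y z) (stepSnd d p x y z)) z = stepSnd d p x y z := by
  have key : (d x z = x ∧ d z x = z) ∨ ProjPair C x z := by
    by_cases hxz : x = z
    · subst hxz
      exact Or.inl ⟨h.d_idem hC _, h.d_idem hC _⟩
    · exact (commPair_or_projPair hxz).imp (fun hc => ⟨h.comm hc, h.comm hc.symm⟩) id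
  rcases key with ⟨h1, h2⟩ | hN
  · obtain ⟨e1, e2⟩ := h.step_of_d_eq hC h1 h2 y
    rw [e1, e2, h1, h.p_idem hC, h1, compl2, h1]
    simp
  · have hd := h.proj hN
    have hd' := h.proj hN.symm
    have hne := hN.1
    have hi := h.d_idem hC z
    rcases h.step_of_projPair hC hN y with ⟨e1, e2⟩ | ⟨e1, e2⟩ <;> rw [e1, e2, hd]
    · rw [h.aab hN, hi, compl2, hi]
      simp [hN]
    · rw [h.abb hN, hd', hd, compl2, hd]
      simp [hN, hne.symm]

end Toolkit

section PixleyStep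

variable {D : Type} {C : ∀ k, Set (Op D k)} {d : D → D → D} {p : D → D → D → D}

lemma IsToolkit.pixley_cases (h : IsToolkit C d p) (hC : IsConsClone C) {v u w : D}
    (hu : u = v ∨ u = w) (hN : v ≠ w → ProjPair C v w) :
    (u = v ∧ p v u w = w) ∨ (u = w ∧ p v u w = v) := by
  by_cases hvw : v = w
  · subst hvw
    have := h.p_idem hC v
    grind
  · have h1 := h.aab (hN hvw)
    have h2 := h.abb (hN hvw)
    grind

lemma IsToolkit.pixley_left_step (h : IsToolkit C d p) (hC : IsConsClone C) {v u w q : D}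
    (hu : u = v ∨ u = w) (hN : v ≠ w → ProjPair C v w) (hq : q = v ∨ q = w) :
    (u = pixMaj p u v q ∨ u = w) ∧
      (pixMaj p u v q ≠ w → ProjPair C (pixMaj p u v q) w) ∧
      (pixMaj p u v q = v ∨ pixMaj p u v q = p (pixMaj p u v q) u w) ∧
      (v ≠ p (pixMaj p u v q) u w → ProjPair C v (p (pixMaj p u v q) u w)) ∧
      p v (pixMaj p u v q) (p (pixMaj p u v q) u w) = p v u w := by
  by_cases hvw : v = w
  · subst hvw
    have h0 := h.p_idem hC v
    obtain rfl : u = v := by grind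
    obtain rfl : q = u := by grind
    simp [pixMaj, h0]
  · have hP := hN hvw
    have h0 := h.p_idem hC v
    have h1 := h.p_idem hC w
    rcases hu with rfl | rfl <;> rcases hq with rfl | rfl <;>
      simp [pixMaj, h0, h1, h.aab hP, h.abb hP, h.aab hP.symm, h.aba hP.symm,
        h.abb hP.symm, hP]

lemma IsToolkit.pixley_left_step_diff (h : IsToolkit C d p) (hC : IsConsClone C)
    {v u w q : D} (hu : u = v ∨ u = w) (hN : v ≠ w → ProjPair C v w) (hq : q = v ∨ q = w) :
    (v = w → pixMaj p u v q = w) ∧ (pixMaj p u v q ≠ v → v ≠ w ∧ pixMaj p u v q = w) ∧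
      (v = w → v = p (pixMaj p u v q) u w) ∧
      (pixMaj p u v q ≠ u → v ≠ w ∧ v = p (pixMaj p u v q) u w) := by
  by_cases hvw : v = w
  · subst hvw
    have h0 := h.p_idem hC v
    obtain rfl : u = v := by grind
    obtain rfl : q = u := by grind
    simp [pixMaj, h0]
  · have hP := hN hvw
    have h0 := h.p_idem hC v
    have h1 := h.p_idem hC w
    rcases hu with rfl | rfl <;> rcases hq with rfl | rfl <;>
      simp [pixMaj, h0, h1, h.aab hP, h.abb hP, h.aab hP.symm, h.aba hP.symm,
        h.abb hP.symm, hvw]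

lemma IsToolkit.pixley_right_step (h : IsToolkit C d p) (hC : IsConsClone C) {v u w q : D}
    (hu : u = v ∨ u = w) (hN : v ≠ w → ProjPair C v w) (hq : q = v ∨ q = w) :
    (u = v ∨ u = pixMaj p u w q) ∧
      (v ≠ pixMaj p u w q → ProjPair C v (pixMaj p u w q)) ∧
      (pixMaj p u w q = p v u (pixMaj p u w q) ∨ pixMaj p u w q = w) ∧
      (p v u (pixMaj p u w q) ≠ w → ProjPair C (p v u (pixMaj p u w q)) w) ∧
      p (p v u (pixMaj p u w q)) (pixMaj p u w q) w = p v u w := by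
  by_cases hvw : v = w
  · subst hvw
    have h0 := h.p_idem hC v
    obtain rfl : u = v := by grind
    obtain rfl : q = u := by grind
    simp [pixMaj, h0]
  · have hP := hN hvw
    have h0 := h.p_idem hC v
    have h1 := h.p_idem hC w
    rcases hu with rfl | rfl <;> rcases hq with rfl | rfl <;>
      simp [pixMaj, h0, h1, h.aab hP, h.aba hP, h.abb hP, h.aab hP.symm,
        h.abb hP.symm, hP]

lemma IsToolkit.pixley_right_step_diff (h : IsToolkit C d p) (hC : IsConsClone C)
    {v u w q : D} (hu : u = v ∨ u = w) (hN : v ≠ w → ProjPair C v w) (hq : q = v ∨ q = w) :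
    (v = w → v = pixMaj p u w q) ∧ (pixMaj p u w q ≠ w → v ≠ w ∧ v = pixMaj p u w q) ∧
      (v = w → p v u (pixMaj p u w q) = w) ∧
      (pixMaj p u w q ≠ u → v ≠ w ∧ p v u (pixMaj p u w q) = w) := by
  by_cases hvw : v = w
  · subst hvw
    have h0 := h.p_idem hC v
    obtain rfl : u = v := by grind
    obtain rfl : q = u := by grind
    simp [pixMaj, h0]
  · have hP := hN hvw
    have h0 := h.p_idem hC v
    have h1 := h.p_idem hC w
    rcases hu with rfl | rfl <;> rcases hq with rfl | rfl <;>
      simp [pixMaj, h0, h1, h.aab hP, h.aba hP, h.abb hP, h.aab hP.symm,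
        h.abb hP.symm, hvw]

lemma IsToolkit.eq_corner_of_pixley_steps (h : IsToolkit C d p) (hC : IsConsClone C)
    {v u w q : D} (hu : u = v ∨ u = w) (hN : v ≠ w → ProjPair C v w) (hq : q = v ∨ q = w) :
    (pixMaj p u v q = u → pixMaj p u w q = u → q = u) ∧
      (pixMaj p u v q = u → pixMaj p u w q = w → q = w) ∧
      (pixMaj p u v q = v → pixMaj p u w q = u → q = v) ∧
      (pixMaj p u v q = v → pixMaj p u w q = w → q = p v u w) := by
  by_cases hvw : v = w
  · subst hvw
    have h0 := h.p_idem hC v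
    obtain rfl : u = v := by grind
    obtain rfl : q = u := by grind
    simp [h0]
  · have hP := hN hvw
    have h0 := h.p_idem hC v
    have h1 := h.p_idem hC w
    rcases hu with rfl | rfl <;> rcases hq with rfl | rfl <;>
      simp [pixMaj, h0, h1, h.aab hP, h.aba hP, h.abb hP, h.aab hP.symm, h.aba hP.symm,
        h.abb hP.symm, hvw, Ne.symm hvw]

end PixleyStep

section ExchangeStep

variable {D : Type} [Fintype D] [DecidableEq D] {Γ : VLang D} {d : D → D → D}
  {p : D → D → D → D}

/-- Exchange of the corners of a rectangle spanned by projection pairs. -/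
lemma IsToolkit.cost_add_pixley_le (hcons : ConservativeLang Γ)
    (h : IsToolkit (PolPlus Γ) d p) {ϱ : Σ r : ℕ, CostF D r} (hϱ : ϱ ∈ Γ)
    (v u w : Fin ϱ.1 → D) (hv : v ∈ Feas ϱ.2) (hu : u ∈ Feas ϱ.2) (hw : w ∈ Feas ϱ.2)
    (huvw : ∀ j, u j = v j ∨ u j = w j)
    (hN : ∀ j, v j ≠ w j → ProjPair (PolPlus Γ) (v j) (w j)) :
    cost ϱ.2 u + cost ϱ.2 (fun j => p (v j) (u j) (w j)) ≤ cost ϱ.2 v + cost ϱ.2 w := by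
  have hC := isConsClone_polPlus hcons
  have hm := terIn_pixMaj hC.toIsClone h.ter
  generalize hn : (Finset.univ.filter fun j => v j ≠ w j).card = n
  induction n using Nat.strong_induction_on generalizing v u w with
  | _ n ih =>
  subst hn
  set u' : Fin ϱ.1 → D := fun j => p (v j) (u j) (w j) with hu'
  have hcases : ∀ j, (u j = v j ∧ u' j = w j) ∨ (u j = w j ∧ u' j = v j) := fun j =>
    h.pixley_cases hC (huvw j) (hN j)
  have hu'F : u' ∈ Feas ϱ.2 := h.ter.mem_feas hϱ hv hu hw
  by_cases huv : u' = v
  · have : u = w := funext fun j => by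
      rcases hcases j with e | e
      · rw [e.1, ← e.2, huv]
      · exact e.1
    rw [huv, this]
    linarith
  by_cases huw : u' = w
  · have : u = v := funext fun j => by
      rcases hcases j with e | e
      · exact e.1
      · rw [e.1, ← e.2, huw]
    rw [huw, this]
  by_cases hcov : ∀ f ∈ PolPlus Γ 3, appRows f ![v, u, w] = u' ∨ appRows f ![v, u, w] = v ∨
      appRows f ![v, u, w] = w ∨ appRows f ![v, u, w] = u
  · obtain ⟨i, hi⟩ := Function.ne_iff.1 huw
    obtain ⟨j, hj⟩ := Function.ne_iff.1 huv
    obtain ⟨hui, hu'i⟩ := (hcases i).resolve_left fun e => hi e.2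
    obtain ⟨huj, hu'j⟩ := (hcases j).resolve_right fun e => hj e.2
    have := (rectangle_exchange hcons hϱ (xs := ![v, u, w]) (i := i) (j := j) (fun l => ?_)
      hu'i.symm hui.symm (hui.symm ▸ hi) hu'j.symm huj.symm (huj.symm ▸ hj)
      hcov (f₀ := fun x => p (x 0) (x 1) (x 2)) h.ter rfl fun l => ?_).2
    · linarith
    · fin_cases l
      exacts [hv, hu, hw]
    · fin_cases l
      · exact Ne.symm huv
      · exact fun e => hi ((congrFun e i).symm.trans hui)
      · exact Ne.symm huw
  push Not at hcov
  obtain ⟨f, hf, hqu', hqv, hqw, hqu⟩ := hcov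
  have hf' := terIn_of_mem hf
  set q : Fin ϱ.1 → D := fun j => f ![v j, u j, w j] with hq
  have hqe : appRows f ![v, u, w] = q := funext fun j => by
    simp only [appRows, hq]
    congr 1
    ext i
    fin_cases i <;> rfl
  rw [hqe] at hqu' hqv hqw hqu
  have hqF : q ∈ Feas ϱ.2 := hf'.mem_feas hϱ hv hu hw
  have hq1 : ∀ j, q j = v j ∨ q j = w j := fun j => by
    rcases hf'.eq_or hC (v j) (u j) (w j) with e | e | e
    · exact Or.inl e
    · exact (huvw j).imp e.trans e.trans
    · exact Or.inr e
  by_cases hA : (fun j => pixMaj p (u j) (v j) (q j)) ≠ v ∧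
      (fun j => pixMaj p (u j) (v j) (q j)) ≠ u
  · obtain ⟨hA1, hA2⟩ := hA
    have hzF : (fun j => pixMaj p (u j) (v j) (q j)) ∈ Feas ϱ.2 := hm.mem_feas hϱ hu hv hqF
    set z : Fin ϱ.1 → D := fun j => pixMaj p (u j) (v j) (q j) with hz
    obtain ⟨i, hi⟩ := Function.ne_iff.1 hA1
    obtain ⟨j, hj⟩ := Function.ne_iff.1 hA2
    have hstep := fun j => h.pixley_left_step hC (huvw j) (hN j) (hq1 j)
    have hdiff := fun j => h.pixley_left_step_diff hC (huvw j) (hN j) (hq1 j)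
    have h1 := ih _ (card_filter_lt (fun j => (hdiff j).1) ⟨i, (hdiff i).2.1 hi⟩) z u w hzF hu
      hw (fun j => (hstep j).1) (fun j => (hstep j).2.1) rfl
    have h2 := ih _ (card_filter_lt (fun j => (hdiff j).2.2.1) ⟨j, (hdiff j).2.2.2 hj⟩) v z
      (fun j => p (z j) (u j) (w j)) hv hzF (h.ter.mem_feas hϱ hzF hu hw)
      (fun j => (hstep j).2.2.1) (fun j => (hstep j).2.2.2.1) rfl
    have e : (fun j => p (v j) (z j) (p (z j) (u j) (w j))) = u' :=
      funext fun j => (hstep j).2.2.2.2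
    rw [e] at h2
    linarith
  by_cases hB : (fun j => pixMaj p (u j) (w j) (q j)) ≠ w ∧
      (fun j => pixMaj p (u j) (w j) (q j)) ≠ u
  · obtain ⟨hB1, hB2⟩ := hB
    have hzF : (fun j => pixMaj p (u j) (w j) (q j)) ∈ Feas ϱ.2 := hm.mem_feas hϱ hu hw hqF
    set z : Fin ϱ.1 → D := fun j => pixMaj p (u j) (w j) (q j) with hz
    obtain ⟨i, hi⟩ := Function.ne_iff.1 hB1
    obtain ⟨j, hj⟩ := Function.ne_iff.1 hB2
    have hstep := fun j => h.pixley_right_step hC (huvw j) (hN j) (hq1 j)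
    have hdiff := fun j => h.pixley_right_step_diff hC (huvw j) (hN j) (hq1 j)
    have h1 := ih _ (card_filter_lt (fun j => (hdiff j).1) ⟨i, (hdiff i).2.1 hi⟩) v u z hv hu
      hzF (fun j => (hstep j).1) (fun j => (hstep j).2.1) rfl
    have h2 := ih _ (card_filter_lt (fun j => (hdiff j).2.2.1) ⟨j, (hdiff j).2.2.2 hj⟩)
      (fun j => p (v j) (u j) (z j)) z w (h.ter.mem_feas hϱ hv hu hzF) hzF hw
      (fun j => (hstep j).2.2.1) (fun j => (hstep j).2.2.2.1) rfl
    have e : (fun j => p (p (v j) (u j) (z j)) (z j) (w j)) = u' :=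
      funext fun j => (hstep j).2.2.2.2
    rw [e] at h2
    linarith
  exfalso
  have hcor := fun j => h.eq_corner_of_pixley_steps hC (huvw j) (hN j) (hq1 j)
  rw [not_and_or, not_not, not_not] at hA hB
  rcases hA with hA | hA <;> rcases hB with hB | hB
  · exact hqu' (funext fun j => (hcor j).2.2.2 (congrFun hA j) (congrFun hB j))
  · exact hqv (funext fun j => (hcor j).2.2.1 (congrFun hA j) (congrFun hB j))
  · exact hqw (funext fun j => (hcor j).2.1 (congrFun hA j) (congrFun hB j))
  · exact hqu (funext fun j => (hcor j).1 (congrFun hA j) (congrFun hB j))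

lemma IsToolkit.cost_step_le (hcons : ConservativeLang Γ)
    (h : IsToolkit (PolPlus Γ) d p) {ϱ : Σ r : ℕ, CostF D r} (hϱ : ϱ ∈ Γ)
    {x y z : Fin ϱ.1 → D} (hx : x ∈ Feas ϱ.2) (hy : y ∈ Feas ϱ.2) (hz : z ∈ Feas ϱ.2) :
    cost ϱ.2 (fun j => stepFst d p (x j) (y j) (z j)) +
        cost ϱ.2 (fun j => stepSnd d p (x j) (y j) (z j)) ≤ cost ϱ.2 x + cost ϱ.2 z := by
  have hC := isConsClone_polPlus hcons
  have hid := fun j => h.step_identities hC (x j) (y j) (z j)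
  have hGF := (terIn_stepFst hC.toIsClone h.bin h.ter).mem_feas hϱ hx hy hz
  have hGF' := (terIn_stepSnd hC.toIsClone h.bin h.ter).mem_feas hϱ hx hy hz
  have h1 := h.cost_add_pixley_le hcons hϱ x _ (fun j => d (x j) (z j)) hx hGF
    (h.bin.mem_feas hϱ hx hz) (fun j => (hid j).1) (fun j => (hid j).2.1)
  have h2 := (cost_add_compl2_le hcons h.bin hϱ _ z (h.bin.mem_feas hϱ hGF hGF') hz).2
  rw [funext fun j => (hid j).2.2.1] at h1
  rw [funext fun j => (hid j).2.2.2.1, funext fun j => (hid j).2.2.2.2] at h2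
  linarith

/-- The multimorphism obtained from two consecutive exchange steps. -/
lemma IsToolkit.exists_mjn (hcons : ConservativeLang Γ) (h : IsToolkit (PolPlus Γ) d p) :
    ∃ mj₁ mj₂ mn₃ : Op D 3, Conservative mj₁ ∧ Conservative mj₂ ∧ Conservative mn₃ ∧
      AdmitsMultimorphism Γ ![mj₁, mj₂, mn₃] ∧
      ∀ x y, ProjPair (PolPlus Γ) x y →
        IsMajorityOn mj₁ {x, y} ∧ IsMajorityOn mj₂ {x, y} ∧ IsMinorityOn mn₃ {x, y} := by
  have hC := isConsClone_polPlus hcons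
  have hg := terIn_stepFst hC.toIsClone h.bin h.ter
  have hg' := terIn_stepSnd hC.toIsClone h.bin h.ter
  have h2 := hC.comp3 hg (hC.pr 1) hg hg'
  have h3 := hC.comp3 hg' (hC.pr 1) hg hg'
  refine ⟨_, _, _, hC.conservative _ _ hg, hC.conservative _ _ h2, hC.conservative _ _ h3,
    ?_, fun x y hxy => ?_⟩
  · refine admitsMultimorphism_of_cost_le (fun i => ?_) fun ϱ hϱ xs hxs => ?_
    · fin_cases i
      exacts [polPlus_subset_pol hg, polPlus_subset_pol h2, polPlus_subset_pol h3]
    · have e1 := h.cost_step_le hcons hϱ (hxs 0) (hxs 1) (hxs 2)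
      have e2 := h.cost_step_le hcons hϱ (hxs 1) (hg.mem_feas hϱ (hxs 0) (hxs 1) (hxs 2))
        (hg'.mem_feas hϱ (hxs 0) (hxs 1) (hxs 2))
      rw [Fin.sum_univ_three, Fin.sum_univ_three]
      have := add_le_add e1 e2
      simp only [Matrix.cons_val_zero, Matrix.cons_val_one, Matrix.cons_val]
      unfold appRows
      linarith
  · have key : ∀ a b, ProjPair (PolPlus Γ) a b ∨ a = b →
        (stepFst d p a a b = a ∧ stepSnd d p a a b = b) ∧
        (stepFst d p a b b = b ∧ stepSnd d p a b b = a) := by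
      rintro a b (hab | rfl)
      · exact ⟨h.step_aab hC hab, h.step_abb hC hab⟩
      · exact ⟨h.step_aba hC a a, h.step_aba hC a a⟩
    have hmem : ∀ a ∈ ({x, y} : Set D), ∀ b ∈ ({x, y} : Set D),
        ProjPair (PolPlus Γ) a b ∨ a = b := by
      rintro a (rfl | rfl) b (rfl | rfl)
      exacts [Or.inr rfl, Or.inl hxy, Or.inl hxy.symm, Or.inr rfl]
    refine ⟨fun a ha b hb => ?_, fun a ha b hb => ?_, fun a ha b hb => ?_⟩ <;>
    · obtain ⟨⟨k1, k2⟩, -⟩ := key a b (hmem a ha b hb)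
      obtain ⟨-, l3, l4⟩ := key b a (hmem b hb a ha)
      obtain ⟨n1, n2⟩ := h.step_aba hC a b
      simp [ap3, k1, k2, l3, l4, n1, n2]

end ExchangeStep

/-! ### Ternary operations on projection pairs -/

/-- The idempotent self-dual Boolean operation which returns the odd argument out exactly
when that argument is the last, middle or first one and `v₁`, `v₂` or `v₃` is set. -/
def selfDual (v₁ v₂ v₃ x y z : Bool) : Bool :=
  if x = y then (if v₁ then z else x)
  else if x = z then (if v₂ then y else x)
  else if v₃ then x else y

/-- `f` acts on `{a, b}` as the self-dual operation with the given parameters. -/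
def ActsAs {D : Type} (f : D → D → D → D) (a b : D) (v₁ v₂ v₃ : Bool) : Prop :=
  ∀ x y z : Bool, f (bif x then b else a) (bif y then b else a) (bif z then b else a) =
    bif selfDual v₁ v₂ v₃ x y z then b else a

/-- Cyclic composition of two ternary operations. -/
def cycComp {A : Type} (m₁ m₂ : A → A → A → A) (x y z : A) : A :=
  m₁ (m₂ x y z) (m₂ y z x) (m₂ z x y)

/-- A term which is a majority operation wherever one of `m₁`, `m₂` is. -/
def majComb {A : Type} (m₁ m₂ : A → A → A → A) (x y z : A) : A :=
  m₁ (cycComp m₁ m₂ x y (cycComp m₁ m₂ x y z)) (cycComp m₁ m₂ y z (cycComp m₁ m₂ x y z))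
    (cycComp m₁ m₂ x z (cycComp m₁ m₂ x y z))

/-- A term which is a Pixley operation wherever `p` or `q` is, provided `m` is a majority
operation and `v₁`, `v₃` describe the action of `p` where it is not a Pixley operation. -/
def pixComb {A : Type} (v₁ v₃ : Bool) (p q m : A → A → A → A) (x y z : A) : A :=
  m (m (m (p x y z) z (bif v₃ then p z y x else p x z z)) z x)
    (m (m (p x y z) x (bif v₁ then p z y x else p x x z)) z x) (q x y z)

section ActsAs

lemma selfDual_majComb (v₁ v₂ v₃ x y z : Bool) :
    majComb (selfDual false false false) (selfDual v₁ v₂ v₃) x y z =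
        selfDual false false false x y z ∧
      majComb (selfDual v₁ v₂ v₃) (selfDual false false false) x y z =
        selfDual false false false x y z := by
  revert v₁ v₂ v₃ x y z
  decide

lemma selfDual_pixComb (v₁ v₂ v₃ x y z : Bool) :
    pixComb v₁ v₃ (selfDual v₁ v₂ v₃) (selfDual true false true)
        (selfDual false false false) x y z = selfDual true false true x y z := by
  revert v₁ v₂ v₃ x y z
  decide

lemma selfDual_pixComb_of_pixley (u₁ u₃ v₁ v₂ v₃ x y z : Bool) :
    pixComb u₁ u₃ (selfDual true false true) (selfDual v₁ v₂ v₃)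
        (selfDual false false false) x y z = selfDual true false true x y z := by
  revert u₁ u₃ v₁ v₂ v₃ x y z
  decide

variable {D : Type} {a b : D} {f g h : D → D → D → D}

lemma ActsAs.majComb {u₁ u₂ u₃ v₁ v₂ v₃ : Bool} (hf : ActsAs f a b u₁ u₂ u₃)
    (hg : ActsAs g a b v₁ v₂ v₃) (x y z : Bool) :
    majComb f g (bif x then b else a) (bif y then b else a) (bif z then b else a) =
      bif majComb (selfDual u₁ u₂ u₃) (selfDual v₁ v₂ v₃) x y z then b else a := by
  simp only [_root_.majComb, cycComp, hf _ _ _, hg _ _ _]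

lemma ActsAs.pixComb {u₁ u₂ u₃ v₁ v₂ v₃ w₁ w₂ w₃ : Bool} (s t : Bool)
    (hf : ActsAs f a b u₁ u₂ u₃) (hg : ActsAs g a b v₁ v₂ v₃) (hh : ActsAs h a b w₁ w₂ w₃)
    (x y z : Bool) :
    pixComb s t f g h (bif x then b else a) (bif y then b else a) (bif z then b else a) =
      bif pixComb s t (selfDual u₁ u₂ u₃) (selfDual v₁ v₂ v₃) (selfDual w₁ w₂ w₃) x y z
        then b else a := by
  cases s <;> cases t <;>
    simp only [_root_.pixComb, cond_true, cond_false, hf _ _ _, hg _ _ _, hh _ _ _]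

variable {C : ∀ k, Set (Op D k)}

lemma TerIn.majComb (hC : IsClone C) (hf : TerIn C f) (hg : TerIn C g) :
    TerIn C (majComb f g) := by
  have key : ∀ {i j l : Op D 3}, i ∈ C 3 → j ∈ C 3 → l ∈ C 3 →
      (fun x => cycComp f g (i x) (j x) (l x)) ∈ C 3 := fun hi hj hl => by
    unfold cycComp
    exact hC.comp3 hf (hC.comp3 hg hi hj hl) (hC.comp3 hg hj hl hi) (hC.comp3 hg hl hi hj)
  have ht := key (hC.pr 0) (hC.pr 1) (hC.pr 2)
  unfold TerIn _root_.majComb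
  exact hC.comp3 hf (key (hC.pr 0) (hC.pr 1) ht) (key (hC.pr 1) (hC.pr 2) ht)
    (key (hC.pr 0) (hC.pr 2) ht)

lemma TerIn.pixComb (hC : IsClone C) (s t : Bool) (hf : TerIn C f) (hg : TerIn C g)
    (hh : TerIn C h) : TerIn C (pixComb s t f g h) := by
  have h0 := hC.pr (k := 3) 0
  have h1 := hC.pr (k := 3) 1
  have h2 := hC.pr (k := 3) 2
  have e1 : (fun x : Fin 3 → D => bif t then f (x 2) (x 1) (x 0) else f (x 0) (x 2) (x 2)) ∈
      C 3 := by
    cases t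
    exacts [hC.comp3 hf h0 h2 h2, hC.comp3 hf h2 h1 h0]
  have e2 : (fun x : Fin 3 → D => bif s then f (x 2) (x 1) (x 0) else f (x 0) (x 0) (x 2)) ∈
      C 3 := by
    cases s
    exacts [hC.comp3 hf h0 h0 h2, hC.comp3 hf h2 h1 h0]
  unfold TerIn _root_.pixComb
  exact hC.comp3 hh (hC.comp3 hh (hC.comp3 hh hf h2 e1) h2 h0)
    (hC.comp3 hh (hC.comp3 hh hf h0 e2) h2 h0) hg

lemma TerIn.idem (hC : IsConsClone C) (hf : TerIn C f) (a : D) : f a a a = a := by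
  have := hf.eq_or hC a a a
  grind

lemma ProjPair.ter_cases (hC : IsConsClone C) (hab : ProjPair C a b) (hf : TerIn C f) :
    ((f a a b = a ∧ f b b a = b) ∨ (f a a b = b ∧ f b b a = a)) ∧
      ((f a b a = a ∧ f b a b = b) ∨ (f a b a = b ∧ f b a b = a)) ∧
      ((f b a a = a ∧ f a b b = b) ∨ (f b a a = b ∧ f a b b = a)) := by
  have h0 := hC.pr (k := 2) 0
  have h1 := hC.pr (k := 2) 1
  have e1 := hab.bin_cases hC (f := fun x y => f x x y) (hC.comp3 hf h0 h0 h1)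
  have e2 := hab.bin_cases hC (f := fun x y => f x y x) (hC.comp3 hf h0 h1 h0)
  have e3 := hab.bin_cases hC (f := fun x y => f y x x) (hC.comp3 hf h1 h0 h0)
  exact ⟨e1, e2, e3⟩

/-- The action on a projection pair is determined by three values. -/
lemma ProjPair.actsAs_of (hC : IsConsClone C) (hab : ProjPair C a b) (hf : TerIn C f)
    {v₁ v₂ v₃ : Bool} (h₁ : f a a b = bif v₁ then b else a)
    (h₂ : f a b a = bif v₂ then b else a) (h₃ : f b a a = bif v₃ then b else a) :
    ActsAs f a b v₁ v₂ v₃ := by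
  obtain ⟨e1, e2, e3⟩ := hab.ter_cases hC hf
  have i1 := hf.idem hC a
  have i2 := hf.idem hC b
  have hne := hab.1
  have k1 : f b b a = bif v₁ then a else b := by cases v₁ <;> simp at h₁ ⊢ <;> grind
  have k2 : f b a b = bif v₂ then a else b := by cases v₂ <;> simp at h₂ ⊢ <;> grind
  have k3 : f a b b = bif v₃ then a else b := by cases v₃ <;> simp at h₃ ⊢ <;> grind
  intro x y z
  cases x <;> cases y <;> cases z <;>
    simp only [selfDual, cond_true, cond_false, h₁, h₂, h₃, i1, i2, k1, k2, k3] <;>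
    first
      | (cases v₁ <;> rfl)
      | (cases v₂ <;> rfl)
      | (cases v₃ <;> rfl)

lemma ProjPair.exists_actsAs (hC : IsConsClone C) (hab : ProjPair C a b) (hf : TerIn C f) :
    ∃ v₁ v₂ v₃, ActsAs f a b v₁ v₂ v₃ := by
  have key : ∀ c, (c = a ∨ c = b) → ∃ v : Bool, c = bif v then b else a := by
    rintro c (rfl | rfl)
    exacts [⟨false, rfl⟩, ⟨true, rfl⟩]
  obtain ⟨v₁, h₁⟩ := key (f a a b) (by have := hf.eq_or hC a a b; grind)
  obtain ⟨v₂, h₂⟩ := key (f a b a) (by have := hf.eq_or hC a b a; grind)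
  obtain ⟨v₃, h₃⟩ := key (f b a a) (by have := hf.eq_or hC b a a; grind)
  exact ⟨v₁, v₂, v₃, hab.actsAs_of hC hf h₁ h₂ h₃⟩

variable [Finite D]

lemma exists_majority_of_local (hC : IsConsClone C)
    (h : ∀ a b, ProjPair C a b → ∃ m, TerIn C m ∧ ActsAs m a b false false false) :
    ∃ m, TerIn C m ∧ ∀ a b, ProjPair C a b → ActsAs m a b false false false := by
  classical
  have := Fintype.ofFinite D
  have key : ∀ S : Finset (D × D), ∃ m, TerIn C m ∧
      ∀ e ∈ S, ProjPair C e.1 e.2 → ActsAs m e.1 e.2 false false false := by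
    intro S
    induction S using Finset.induction_on with
    | empty => exact ⟨fun a _ _ => a, hC.pr 0, by simp⟩
    | insert e S _ ih =>
      obtain ⟨m₁, hm₁, hS⟩ := ih
      by_cases he : ProjPair C e.1 e.2
      · obtain ⟨m₂, hm₂, hme⟩ := h _ _ he
        refine ⟨majComb m₁ m₂, hm₁.majComb hC.toIsClone hm₂, fun e' he' hp => ?_⟩
        rcases Finset.mem_insert.1 he' with rfl | hmem
        · obtain ⟨v₁, v₂, v₃, hv⟩ := hp.exists_actsAs hC hm₁
          intro x y z
          rw [hv.majComb hme, (selfDual_majComb v₁ v₂ v₃ x y z).2]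
        · obtain ⟨v₁, v₂, v₃, hv⟩ := hp.exists_actsAs hC hm₂
          intro x y z
          rw [(hS e' hmem hp).majComb hv, (selfDual_majComb v₁ v₂ v₃ x y z).1]
      · refine ⟨m₁, hm₁, fun e' he' hp => ?_⟩
        rcases Finset.mem_insert.1 he' with rfl | hmem
        exacts [absurd hp he, hS e' hmem hp]
  obtain ⟨m, hm, hS⟩ := key Finset.univ
  exact ⟨m, hm, fun a b => hS (a, b) (Finset.mem_univ _)⟩

lemma exists_pixley_of_local (hC : IsConsClone C) {m : D → D → D → D} (hm : TerIn C m)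
    (hmaj : ∀ a b, ProjPair C a b → ActsAs m a b false false false)
    (h : ∀ a b, ProjPair C a b → ∃ p, TerIn C p ∧ ActsAs p a b true false true) :
    ∃ p, TerIn C p ∧ ∀ a b, ProjPair C a b → ActsAs p a b true false true := by
  classical
  have := Fintype.ofFinite D
  have key : ∀ S : Finset (D × D), ∃ p, TerIn C p ∧
      ∀ e ∈ S, ProjPair C e.1 e.2 → ActsAs p e.1 e.2 true false true := by
    intro S
    induction S using Finset.induction_on with
    | empty => exact ⟨fun a _ _ => a, hC.pr 0, by simp⟩
    | insert e S _ ih =>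
      obtain ⟨p, hp, hS⟩ := ih
      by_cases he : ProjPair C e.1 e.2
      · obtain ⟨q, hq, hqe⟩ := h _ _ he
        obtain ⟨v₁, v₂, v₃, hv⟩ := he.exists_actsAs hC hp
        refine ⟨pixComb v₁ v₃ p q m, hp.pixComb hC.toIsClone _ _ hq hm, fun e' he' hP => ?_⟩
        rcases Finset.mem_insert.1 he' with rfl | hmem
        · intro x y z
          rw [hv.pixComb _ _ hqe (hmaj _ _ hP), selfDual_pixComb]
        · obtain ⟨w₁, w₂, w₃, hw⟩ := hP.exists_actsAs hC hq
          intro x y z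
          rw [(hS e' hmem hP).pixComb _ _ hw (hmaj _ _ hP), selfDual_pixComb_of_pixley]
      · refine ⟨p, hp, fun e' he' hP => ?_⟩
        rcases Finset.mem_insert.1 he' with rfl | hmem
        exacts [absurd hP he, hS e' hmem hP]
  obtain ⟨p, hp, hS⟩ := key Finset.univ
  exact ⟨p, hp, fun a b => hS (a, b) (Finset.mem_univ _)⟩

end ActsAs

/-! ### From cyclic operations to majority and Pixley operations -/

section Cyclic

variable {D : Type} {C : ∀ k, Set (Op D k)} {a b : D}

lemma IsClone.minor_mem (hC : IsClone C) {k m : ℕ} {f : Op D k} (hf : f ∈ C k)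
    (φ : Fin k → Fin m) : (fun x : Fin m → D => f fun j => x (φ j)) ∈ C m :=
  hC.superpose_mem k m f (fun j x => x (φ j)) hf fun j => hC.pr (φ j)

/-- A cyclic operation produces a ternary one whose action on a projection pair is
not that of a (possibly relabelled) projection. -/
lemma ProjPair.exists_of_cyclic (hC : IsConsClone C) (hab : ProjPair C a b) {k : ℕ}
    (hk : 1 < k) {f : Op D k} (hf : f ∈ C k) (hcyc : CyclicOp f) :
    ∃ h v₁ v₂ v₃, TerIn C h ∧ ActsAs h a b v₁ v₂ v₃ ∧
      v₁.toNat + v₂.toNat + v₃.toNat ≠ 1 := by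
  classical
  let F : Finset (Fin k) → D := fun S => f fun j => if j ∈ S then b else a
  have hF : ∀ S, F S = a ∨ F S = b := by
    intro S
    obtain ⟨i, hi⟩ := hC.conservative k f hf fun j => if j ∈ S then b else a
    by_cases h : i ∈ S
    · exact Or.inr (by simpa [h] using hi)
    · exact Or.inl (by simpa [h] using hi)
  have huniv : F Finset.univ = b := by
    obtain ⟨i, hi⟩ := hC.conservative k f hf fun j => if j ∈ Finset.univ then b else a
    simpa [F] using hi
  have hempty : F ∅ = a := by
    obtain ⟨i, hi⟩ := hC.conservative k f hf fun j => if j ∈ (∅ : Finset (Fin k)) then b else a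
    simpa [F] using hi
  obtain ⟨S, hS, hmin⟩ := Finset.exists_min_image
    (Finset.univ.filter fun S => F S = b) Finset.card ⟨Finset.univ, by simp [huniv]⟩
  have hSb : F S = b := (Finset.mem_filter.1 hS).2
  obtain ⟨i, hi⟩ : S.Nonempty := by
    rw [Finset.nonempty_iff_ne_empty]
    rintro rfl
    exact hab.1 (hempty.symm.trans hSb)
  by_cases hsing : S = {i}
  · subst hsing
    obtain ⟨i', hne, hi'⟩ : ∃ i', i' ≠ i ∧ F {i'} = b := by
      refine ⟨(finRotate k).symm i, fun h => ?_, ?_⟩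
      · obtain ⟨n, rfl⟩ : ∃ n, k = n + 2 := ⟨k - 2, by omega⟩
        rw [Equiv.symm_apply_eq, finRotate_apply] at h
        simp at h
      · have h := hcyc fun j => if j ∈ ({i} : Finset (Fin k)) then b else a
        refine Eq.trans (Eq.trans ?_ h.symm) hSb
        simp only [F, Function.comp_def, Finset.mem_singleton, Equiv.eq_symm_apply]
    let φ : Fin k → Fin 3 := fun j => if j = i then 0 else if j = i' then 1 else 2
    have hh := terIn_of_mem (hC.minor_mem hf φ)
    have e2 : (f fun j => ![a, b, a] (φ j)) = b := by
      refine Eq.trans ?_ hi'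
      congr 1
      funext j
      by_cases h : j = i
      · subst h
        simp [φ, hne.symm]
      · by_cases h' : j = i' <;> simp [φ, h, h', hne]
    have e3 : (f fun j => ![b, a, a] (φ j)) = b := by
      refine Eq.trans ?_ hSb
      congr 1
      funext j
      by_cases h : j = i
      · subst h
        simp [φ]
      · by_cases h' : j = i' <;> simp [φ, h, h', hne]
    obtain ⟨v₁, e1⟩ : ∃ v : Bool, (f fun j => ![a, a, b] (φ j)) = bif v then b else a := by
      rcases hh.eq_or hC a a b with h | h | h
      exacts [⟨false, h⟩, ⟨false, h⟩, ⟨true, h⟩]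
    refine ⟨_, v₁, true, true, hh, hab.actsAs_of hC hh e1 e2 e3, ?_⟩
    cases v₁ <;> decide
  · let φ : Fin k → Fin 3 := fun j => if j = i then 0 else if j ∈ S then 1 else 2
    have hh := terIn_of_mem (hC.minor_mem hf φ)
    have hlt : ∀ T : Finset (Fin k), T.card < S.card → F T = a := fun T hT =>
      (hF T).resolve_right fun h => (hmin T (by simp [h])).not_gt hT
    have e3 : (f fun j => ![b, a, a] (φ j)) = a := by
      refine Eq.trans ?_ (hlt {i} (Finset.card_lt_card (Finset.ssubset_iff_subset_ne.2
        ⟨by simpa using hi, fun h => hsing h.symm⟩)))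
      congr 1
      funext j
      by_cases h : j = i <;> by_cases h' : j ∈ S <;> simp [φ, h, h']
    have e2 : (f fun j => ![a, b, a] (φ j)) = a := by
      refine Eq.trans ?_ (hlt (S.erase i) (Finset.card_erase_lt_of_mem hi))
      congr 1
      funext j
      by_cases h : j = i <;> by_cases h' : j ∈ S <;> simp [φ, h, h']
    have e1 : (f fun j => ![a, a, b] (φ j)) = a := by
      have hg := hab.bin_cases hC (binIn_of_mem (hC.minor_mem hf
        (fun j => if j ∈ S then (1 : Fin 2) else 0)))
      have h1 : (f fun j => ![a, b] (if j ∈ S then (1 : Fin 2) else 0)) = b := by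
        refine Eq.trans ?_ hSb
        congr 1
        funext j
        by_cases h' : j ∈ S <;> simp [h']
      have h2 : (f fun j => ![b, a] (if j ∈ S then (1 : Fin 2) else 0)) =
          f fun j => ![a, a, b] (φ j) := by
        congr 1
        funext j
        by_cases h : j = i
        · subst h
          simp [φ, hi]
        · by_cases h' : j ∈ S <;> simp [φ, h, h']
      rw [← h2]
      rcases hg with h | h
      · exact absurd (h.1.symm.trans h1) hab.1
      · exact h.2
    exact ⟨_, false, false, false, hh, hab.actsAs_of hC hh e1 e2 e3, by decide⟩

lemma ActsAs.pixley_of_two {C : ∀ k, Set (Op D k)} (hC : IsClone C) {n m : D → D → D → D}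
    (hn : TerIn C n) (hm : TerIn C m) (ham : ActsAs m a b false false false)
    {v₁ v₂ v₃ : Bool} (han : ActsAs n a b v₁ v₂ v₃)
    (h : 1 < v₁.toNat + v₂.toNat + v₃.toNat) :
    ∃ p, TerIn C p ∧ ActsAs p a b true false true := by
  have h0 := hC.pr (k := 3) 0
  have h1 := hC.pr (k := 3) 1
  have h2 := hC.pr (k := 3) 2
  cases v₁ <;> cases v₂ <;> cases v₃ <;> try (exact absurd h (by decide))
  · refine ⟨fun x y z => n x z y, hC.comp3 hn h0 h2 h1, fun x y z => (han x z y).trans ?_⟩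
    cases x <;> cases y <;> cases z <;> rfl
  · exact ⟨n, hn, han⟩
  · refine ⟨fun x y z => n y x z, hC.comp3 hn h1 h0 h2, fun x y z => (han y x z).trans ?_⟩
    cases x <;> cases y <;> cases z <;> rfl
  · refine ⟨fun x y z => n x (m x y z) z, hC.comp3 hn h0 hm h2, fun x y z => ?_⟩
    simp only [ham x y z, han _ _ _]
    cases x <;> cases y <;> cases z <;> rfl

end Cyclic

section Balance

variable {D : Type} [DecidableEq D] {Γ : VLang D} {a b : D}

/-- The number of arguments whose deviation decides the value of `f` on `{a, b}`. -/
def oddCount (a b : D) (f : Op D 3) : ℚ :=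
  (if f ![a, a, b] = b then 1 else 0) + (if f ![a, b, a] = b then 1 else 0) +
    if f ![b, a, a] = b then 1 else 0

lemma oddCount_of_isProj (hab : a ≠ b) {f : Op D 3} (hf : IsProj f) : oddCount a b f = 1 := by
  obtain ⟨i, rfl⟩ := hf
  fin_cases i <;> simp [oddCount, proj, hab]

lemma oddCount_of_actsAs (hab : a ≠ b) {h : D → D → D → D} {v₁ v₂ v₃ : Bool}
    (hh : ActsAs h a b v₁ v₂ v₃) :
    oddCount a b (fun x => h (x 0) (x 1) (x 2)) =
      ((v₁.toNat + v₂.toNat + v₃.toNat : ℕ) : ℚ) := by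
  have h1 := hh false false true
  have h2 := hh false true false
  have h3 := hh true false false
  simp only [cond_true, cond_false] at h1 h2 h3
  simp only [oddCount, Matrix.cons_val_zero, Matrix.cons_val_one, Matrix.cons_val, h1, h2, h3]
  cases v₁ <;> cases v₂ <;> cases v₃ <;> norm_num [selfDual, hab]

variable [Fintype D]

lemma IsValid.sum_oddCount (hcons : ConservativeLang Γ) {ω : Op D 3 → ℚ} (hω : IsValid Γ ω) :
    ∑ f, ω f * (oddCount a b f - 1) = 0 := by
  have h1 := sum_ite_eq_zero hcons hω ![a, a, b] b
  have h2 := sum_ite_eq_zero hcons hω ![a, b, a] b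
  have h3 := sum_ite_eq_zero hcons hω ![b, a, a] b
  have h4 := hω.sum_zero
  have : ∀ f : Op D 3, ω f * (oddCount a b f - 1) =
      ω f * (if f ![a, a, b] = b then 1 else 0) + ω f * (if f ![a, b, a] = b then 1 else 0) +
        ω f * (if f ![b, a, a] = b then 1 else 0) - ω f := by
    intro f
    rw [oddCount]
    ring
  simp only [this, Finset.sum_sub_distrib, Finset.sum_add_distrib, h1, h2, h3, h4]
  norm_num

/-- If some ternary operation deviates from the average, there are deviations in both
directions. -/
lemma exists_oddCount_lt_gt (hcons : ConservativeLang Γ) (hab : a ≠ b) {g : Op D 3}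
    (hg : g ∈ PolPlus Γ 3) (hgc : oddCount a b g ≠ 1) :
    (∃ f ∈ PolPlus Γ 3, oddCount a b f < 1) ∧ ∃ f ∈ PolPlus Γ 3, 1 < oddCount a b f := by
  rcases hg with hp | ⟨ω, hω, hpos⟩
  · exact absurd (oddCount_of_isProj hab hp) hgc
  have hv := (mem_wPol_iff.1 hω).1
  have hneg := (mem_wPol_iff.1 hω).2
  have hsum := hv.sum_oddCount (a := a) (b := b) hcons
  have hgne : ω g * (oddCount a b g - 1) ≠ 0 :=
    mul_ne_zero hpos.ne' (sub_ne_zero.2 hgc)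
  have key : ∀ f, f ∉ PolPlus Γ 3 ∨ oddCount a b f = 1 → ω f * (oddCount a b f - 1) = 0 := by
    rintro f (hf | hf)
    · rcases lt_trichotomy (ω f) 0 with h | h | h
      · exact absurd (Or.inl (hneg f h)) hf
      · rw [h, zero_mul]
      · exact absurd (Or.inr ⟨ω, hω, h⟩) hf
    · rw [hf, sub_self, mul_zero]
  have key' : ∀ f, oddCount a b f ≠ 1 → 0 ≤ ω f := fun f hf =>
    not_lt.1 fun h => hf (oddCount_of_isProj hab (hneg f h))
  constructor
  · by_contra! hcon
    refine hgne ((Finset.sum_eq_zero_iff_of_nonneg fun f _ => ?_).1 hsum g (Finset.mem_univ g))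
    by_cases hf : f ∉ PolPlus Γ 3 ∨ oddCount a b f = 1
    · exact (key f hf).ge
    · push Not at hf
      exact mul_nonneg (key' f hf.2) (sub_nonneg.2 (hcon f hf.1))
  · by_contra! hcon
    refine hgne ((Finset.sum_eq_zero_iff_of_nonpos fun f _ => ?_).1 hsum g (Finset.mem_univ g))
    by_cases hf : f ∉ PolPlus Γ 3 ∨ oddCount a b f = 1
    · exact (key f hf).le
    · push Not at hf
      exact mul_nonpos_of_nonneg_of_nonpos (key' f hf.2) (sub_nonpos.2 (hcon f hf.1))

lemma exists_actsAs_of_mem (hC : IsConsClone (PolPlus Γ)) (hab : ProjPair (PolPlus Γ) a b)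
    {f : Op D 3} (hf : f ∈ PolPlus Γ 3) :
    ∃ h v₁ v₂ v₃, TerIn (PolPlus Γ) h ∧ ActsAs h a b v₁ v₂ v₃ ∧
      oddCount a b f = ((v₁.toNat + v₂.toNat + v₃.toNat : ℕ) : ℚ) := by
  have hh := terIn_of_mem hf
  obtain ⟨v₁, v₂, v₃, hv⟩ := hab.exists_actsAs hC hh
  refine ⟨_, v₁, v₂, v₃, hh, hv, ?_⟩
  rw [← oddCount_of_actsAs hab.1 hv]
  rfl

/-- An idempotent cyclic operation in the positive clone of a conservative language yields a
majority and a Pixley operation on each projection pair, hence on all of them at once. -/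
lemma exists_pixley_of_cyclic (hcons : ConservativeLang Γ) {k : ℕ} (hk : 1 < k) {f : Op D k}
    (hf : f ∈ PolPlus Γ k) (hcyc : CyclicOp f) :
    ∃ p, TerIn (PolPlus Γ) p ∧ ∀ a b, ProjPair (PolPlus Γ) a b → ActsAs p a b true false true := by
  have hC := isConsClone_polPlus hcons
  have hloc : ∀ a b, ProjPair (PolPlus Γ) a b →
      (∃ m, TerIn (PolPlus Γ) m ∧ ActsAs m a b false false false) ∧
        ∃ n v₁ v₂ v₃, TerIn (PolPlus Γ) n ∧ ActsAs n a b v₁ v₂ v₃ ∧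
          1 < v₁.toNat + v₂.toNat + v₃.toNat := by
    intro a b hab
    obtain ⟨h, v₁, v₂, v₃, hh, hv, hne⟩ := hab.exists_of_cyclic hC hk hf hcyc
    obtain ⟨⟨g, hg, hlt⟩, g', hg', hgt⟩ := exists_oddCount_lt_gt hcons hab.1 hh
      (by rw [oddCount_of_actsAs hab.1 hv]; exact_mod_cast hne)
    obtain ⟨m, w₁, w₂, w₃, hm, ham, hw⟩ := exists_actsAs_of_mem hC hab hg
    obtain ⟨n, u₁, u₂, u₃, hn, han, hu⟩ := exists_actsAs_of_mem hC hab hg'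
    rw [hw] at hlt
    rw [hu] at hgt
    refine ⟨⟨m, hm, ?_⟩, n, u₁, u₂, u₃, hn, han, by exact_mod_cast hgt⟩
    have hlt' : w₁.toNat + w₂.toNat + w₃.toNat < 1 := by exact_mod_cast hlt
    cases w₁ <;> cases w₂ <;> cases w₃ <;> first | exact ham | exact absurd hlt' (by decide)
  obtain ⟨m, hm, hmaj⟩ := exists_majority_of_local hC fun a b hab => (hloc a b hab).1
  refine exists_pixley_of_local hC hm hmaj fun a b hab => ?_
  obtain ⟨n, v₁, v₂, v₃, hn, han, hlt⟩ := (hloc a b hab).2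
  exact ActsAs.pixley_of_two hC.toIsClone hn hm (hmaj a b hab) han hlt

end Balance

/-! ### Multimorphisms from a cyclic operation -/

section Forward

variable {D : Type} [Fintype D] [DecidableEq D] {Γ : VLang D}

lemma isToolkit_of_pixley (hcons : ConservativeLang Γ) {s : D → D → D}
    (hs : BinIn (PolPlus Γ) s) (hcomm : ∀ a b, CommPair (PolPlus Γ) a b → s a b = s b a)
    (hleft : ∀ a b, ProjPair (PolPlus Γ) a b → s a b = a) {p : D → D → D → D}
    (hp : TerIn (PolPlus Γ) p) (hpix : ∀ a b, ProjPair (PolPlus Γ) a b →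
      p a a b = b ∧ p a b a = a ∧ p a b b = a) :
    IsToolkit (PolPlus Γ) (fun x y => compl2 s x (s y x)) p where
  bin := by
    have hC := isConsClone_polPlus hcons
    have h0 := hC.pr (k := 2) 0
    exact hC.comp2 (binIn_compl2 hcons hs).1 h0 (hC.comp2 hs (hC.pr 1) h0)
  ter := hp
  comm := fun {a b} hab => by
    have hC := isConsClone_polPlus hcons
    have h1 := hs.idem hC a
    have h2 := hcomm a b hab
    have h3 := hs.eq_or hC a b
    have h4 := hab.1
    unfold compl2
    grind
  proj := fun {a b} hab => by
    rw [hleft b a hab.symm, compl2, if_pos (hleft a b hab)]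
  aab := fun hab => (hpix _ _ hab).1
  aba := fun hab => (hpix _ _ hab).2.1
  abb := fun hab => (hpix _ _ hab).2.2

/-- A positive clone with a cyclic operation yields the two multimorphisms. -/
lemma exists_multimorphisms_of_cyclic (hcons : ConservativeLang Γ) {k : ℕ} (hk : 1 < k)
    {f : Op D k} (hf : f ∈ PolPlus Γ k) (hcyc : CyclicOp f) :
    ∃ (meet join : Op D 2) (mj₁ mj₂ mn₃ : Op D 3) (M : Set (Set D)),
      Conservative meet ∧ Conservative join ∧
      Conservative mj₁ ∧ Conservative mj₂ ∧ Conservative mn₃ ∧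
      AdmitsMultimorphism Γ ![meet, join] ∧
      AdmitsMultimorphism Γ ![mj₁, mj₂, mn₃] ∧
      (∀ S ∈ M, ∃ x y : D, x ≠ y ∧ S = {x, y}) ∧
      (∀ x y : D, x ≠ y → ({x, y} : Set D) ∈ M →
        ∀ a ∈ ({x, y} : Set D), ∀ b ∈ ({x, y} : Set D),
          ap2 meet a b = ap2 meet b a ∧ ap2 join a b = ap2 join b a ∧
          (a ≠ b → ap2 meet a b ≠ ap2 join a b)) ∧
      (∀ x y : D, x ≠ y → ({x, y} : Set D) ∉ M →
        IsMajorityOn mj₁ {x, y} ∧ IsMajorityOn mj₂ {x, y} ∧ IsMinorityOn mn₃ {x, y}) := by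
  have hC := isConsClone_polPlus hcons
  obtain ⟨p, hp, hact⟩ := exists_pixley_of_cyclic hcons hk hf hcyc
  obtain ⟨s, hs, hcomm, hleft⟩ := exists_commutative_or_left hC
  have ht := isToolkit_of_pixley hcons hs hcomm hleft hp fun a b hab =>
    ⟨hact a b hab false false true, hact a b hab false true false, hact a b hab false true true⟩
  obtain ⟨hjoin, hadm⟩ := binIn_compl2 hcons hs
  obtain ⟨mj₁, mj₂, mn₃, c₁, c₂, c₃, hmjn, hproj⟩ := ht.exists_mjn hcons
  refine ⟨_, _, mj₁, mj₂, mn₃, {S | ∃ x y, CommPair (PolPlus Γ) x y ∧ S = {x, y}},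
    hC.conservative 2 _ hs, hC.conservative 2 _ hjoin, c₁, c₂, c₃, hadm, hmjn, ?_, ?_, ?_⟩
  · rintro S ⟨x, y, hxy, rfl⟩
    exact ⟨x, y, hxy.1, rfl⟩
  · rintro x y hxy ⟨x', y', hp', he⟩ a ha b hb
    have hmem : a ≠ b → CommPair (PolPlus Γ) a b := by
      intro hab
      have h' := hp'.symm
      rw [he] at ha hb
      grind
    simp only [ap2, Matrix.cons_val_zero, Matrix.cons_val_one]
    by_cases hab : a = b
    · subst hab
      exact ⟨rfl, rfl, fun h => absurd rfl h⟩
    · have h1 := hcomm a b (hmem hab)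
      have h2 := hs.eq_or hC a b
      have h3 := compl2_cases (hs.eq_or hC) a b
      have h4 := compl2_cases (hs.eq_or hC) b a
      unfold compl2
      grind
  · intro x y hxy hM
    refine hproj x y ((commPair_or_projPair hxy).resolve_left fun h => hM ⟨x, y, h, rfl⟩)

end Forward

/-! ### Constant tuples in shift-invariant relations -/

/-- Operations of a clone used to find constant tuples: `s` and `t` are complementary and
commutative on commutative pairs, `d` and `p` form a toolkit and `m` is a majority operation. -/
structure IsCyclicKit {D : Type} (C : ∀ k, Set (Op D k)) (s t d : D → D → D)
    (p m : D → D → D → D) : Prop extends IsToolkit C d p where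
  cons : IsConsClone C
  fst_in : BinIn C s
  snd_in : BinIn C t
  fst_comm : ∀ {a b}, CommPair C a b → s a b = s b a
  compl : ∀ a b, (s a b = a ∧ t a b = b) ∨ (s a b = b ∧ t a b = a)
  maj_in : TerIn C m
  maj_aab : ∀ a b, m a a b = a
  maj_aba : ∀ a b, m a b a = a
  maj_baa : ∀ a b, m b a a = a

/-- A binary relation preserved by the binary and ternary operations of `C`. -/
structure PairClosed {D : Type} (C : ∀ k, Set (Op D k)) (E : D → D → Prop) : Prop where
  bin : ∀ {f}, BinIn C f → ∀ {x y a b}, E x a → E y b → E (f x y) (f a b)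
  ter : ∀ {f}, TerIn C f → ∀ {x y z a b c}, E x a → E y b → E z c → E (f x y z) (f a b c)

/-- A set of tuples preserved by the binary and ternary operations of `C`. -/
structure TupleClosed {D ι : Type} (C : ∀ k, Set (Op D k)) (R : Set (ι → D)) : Prop where
  bin : ∀ {f}, BinIn C f → ∀ {u v}, u ∈ R → v ∈ R → (fun j => f (u j) (v j)) ∈ R
  ter : ∀ {f}, TerIn C f → ∀ {u v w}, u ∈ R → v ∈ R → w ∈ R →
    (fun j => f (u j) (v j) (w j)) ∈ R

/-- `B` has no proper nonempty subset absorbing it with respect to `s`. -/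
def AbsorptionFree {D : Type} (s : D → D → D) (B : Set D) : Prop :=
  ∀ X ⊆ B, X.Nonempty → (∀ x ∈ X, ∀ y ∈ B, y ∉ X → s x y = x ∧ s y x = x) → B ⊆ X

/-- Pairwise intersecting sets closed under a majority-like operation have a common point. -/
lemma exists_forall_mem_of_pairwise {X ι : Type} {A : Set X} {S : ι → Set X}
    {μ : X → X → X → X} (hA : ∀ i, S i ⊆ A)
    (h₁ : ∀ i, ∀ x ∈ S i, ∀ y ∈ S i, ∀ z ∈ A, μ x y z ∈ S i)
    (h₂ : ∀ i, ∀ x ∈ S i, ∀ y ∈ S i, ∀ z ∈ A, μ x z y ∈ S i)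
    (h₃ : ∀ i, ∀ x ∈ S i, ∀ y ∈ S i, ∀ z ∈ A, μ z x y ∈ S i)
    (J : Finset ι) (hJ : J.Nonempty) (hpair : ∀ i ∈ J, ∀ j ∈ J, (S i ∩ S j).Nonempty) :
    ∃ x, ∀ i ∈ J, x ∈ S i := by
  classical
  induction J using Finset.strongInduction with
  | H J ih =>
    by_cases hcard : 2 < J.card
    · obtain ⟨a, ha, b, hb, c, hc, hab, hac, hbc⟩ := Finset.two_lt_card.1 hcard
      have key : ∀ e ∈ J, ∃ x, ∀ i ∈ J, i ≠ e → x ∈ S i := by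
        intro e he
        obtain ⟨x, hx⟩ := ih (J.erase e) (Finset.erase_ssubset he)
          (Finset.card_pos.1 (by rw [Finset.card_erase_of_mem he]; omega))
          fun i hi j hj => hpair i (Finset.mem_of_mem_erase hi) j (Finset.mem_of_mem_erase hj)
        exact ⟨x, fun i hi hie => hx i (Finset.mem_erase.2 ⟨hie, hi⟩)⟩
      obtain ⟨x, hx⟩ := key a ha
      obtain ⟨y, hy⟩ := key b hb
      obtain ⟨z, hz⟩ := key c hc
      have hxA := hA b (hx b hb hab.symm)
      have hyA := hA a (hy a ha hab)
      have hzA := hA a (hz a ha hac)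
      refine ⟨μ x y z, fun i hi => ?_⟩
      by_cases hia : i = a
      · subst hia
        exact h₃ i y (hy i hi hab) z (hz i hi hac) x hxA
      by_cases hib : i = b
      · subst hib
        exact h₂ i x (hx i hi hia) z (hz i hi hbc) y hyA
      · exact h₁ i x (hx i hi hia) y (hy i hi hib) z hzA
    · obtain ⟨i, hi⟩ := hJ
      have : ∃ j ∈ J, ∀ l ∈ J, l = i ∨ l = j := by
        by_contra! hcon
        obtain ⟨j, hj, hji, -⟩ := hcon i hi
        obtain ⟨l, hl, hli, hlj⟩ := hcon j hj
        exact hcard (Finset.two_lt_card.2 ⟨i, hi, j, hj, l, hl, hji.symm, hli.symm, hlj.symm⟩)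
      obtain ⟨j, hj, hij⟩ := this
      obtain ⟨x, hxi, hxj⟩ := hpair i hi j hj
      refine ⟨x, fun l hl => ?_⟩
      rcases hij l hl with rfl | rfl
      exacts [hxi, hxj]

section Relations

variable {D : Type} {C : ∀ k, Set (Op D k)} {s t d : D → D → D} {p m : D → D → D → D}
  {E θ : D → D → Prop} {B : Set D}

/-- A missing corner of a rectangle forces both sides to be commutative pairs on which the
operation `s` acts in the same direction. -/
lemma PairClosed.comm_of_not (hE : PairClosed C E) (h : IsCyclicKit C s t d p m) {x y a b : D}
    (hxa : E x a) (hyb : E y b) (hya : E y a) (hxb : ¬ E x b) :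
    CommPair C a b ∧ (s a b = a ↔ s x y = x) := by
  have hxy : x ≠ y := by
    rintro rfl
    exact hxb hyb
  have hab : a ≠ b := by
    rintro rfl
    exact hxb hxa
  rcases commPair_or_projPair (C := C) hxy with c₁ | c₁ <;>
    rcases commPair_or_projPair (C := C) hab with c₂ | c₂
  · refine ⟨c₂, ?_⟩
    have hs := hE.bin h.fst_in hxa hyb
    have ht := hE.bin h.snd_in hxa hyb
    rcases h.compl x y with ⟨e₁, e₂⟩ | ⟨e₁, e₂⟩ <;> rcases h.compl a b with ⟨e₃, e₄⟩ | ⟨e₃, e₄⟩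
    · exact iff_of_true e₃ e₁
    · rw [e₁, e₃] at hs
      exact absurd hs hxb
    · rw [e₂, e₄] at ht
      exact absurd ht hxb
    · rw [e₁, e₃]
      exact iff_of_false hab.symm hxy.symm
  · have := hE.bin h.bin hxa hyb
    rw [h.comm c₁, h.proj c₂] at this
    exact absurd this hxb
  · have := hE.bin h.bin hyb hxa
    rw [h.proj c₁.symm, h.comm c₂.symm] at this
    exact absurd this hxb
  · have := hE.ter h.ter hxa hya hyb
    rw [h.abb c₁, h.aab c₂] at this
    exact absurd this hxb

/-- A closed linked relation on an absorption-free set is full. -/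
lemma PairClosed.full (hE : PairClosed C E) (h : IsCyclicKit C s t d p m) [Finite D]
    (hB : AbsorptionFree s B) (hsub : ∀ x a, E x a → x ∈ B ∧ a ∈ B)
    (hleft : ∀ x ∈ B, ∃ a, E x a) (hlink : ∀ a ∈ B, ∀ b ∈ B, ∃ x, E x a ∧ E x b) :
    ∀ x ∈ B, ∀ a ∈ B, E x a := by
  classical
  have := Fintype.ofFinite D
  by_contra! hcon
  obtain ⟨w, hw, b, hb, hwb⟩ := hcon
  obtain ⟨z, hz⟩ : ∃ z, ∀ a ∈ B, E z a := by
    obtain ⟨z, hz⟩ := exists_forall_mem_of_pairwise (A := B) (S := fun a => {x | E x a}) (μ := m)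
      (fun a x hx => (hsub x a hx).1)
      (fun a x hx y hy z hz => by
        obtain ⟨c, hc⟩ := hleft z hz
        have := hE.ter h.maj_in hx hy hc
        rwa [h.maj_aab] at this)
      (fun a x hx y hy z hz => by
        obtain ⟨c, hc⟩ := hleft z hz
        have := hE.ter h.maj_in hx hc hy
        rwa [h.maj_aba] at this)
      (fun a x hx y hy z hz => by
        obtain ⟨c, hc⟩ := hleft z hz
        have := hE.ter h.maj_in hc hx hy
        rwa [h.maj_baa] at this)
      (Finset.univ.filter (· ∈ B)) ⟨b, by simpa using hb⟩
      (fun a ha b hb => hlink a (by simpa using ha) b (by simpa using hb))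
    exact ⟨z, fun a ha => hz a (by simpa using ha)⟩
  have key : ∀ a, E w a → ∀ c ∈ B, ¬ E w c → CommPair C a c ∧ (s a c = a ↔ s w z = w) :=
    fun a ha c hc hwc => hE.comm_of_not h ha (hz c hc) (hz a (hsub w a ha).2) hwc
  by_cases hswz : s w z = w
  · refine hwb (hB {a | E w a} (fun a ha => (hsub w a ha).2) (hleft w hw) ?_ hb)
    intro a ha c hc hwc
    obtain ⟨hac, hiff⟩ := key a ha c hc hwc
    have := hiff.2 hswz
    exact ⟨this, (h.fst_comm hac).symm.trans this⟩
  · obtain ⟨a, ha⟩ := hleft w hw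
    refine (hB {c | c ∈ B ∧ ¬ E w c} (fun c hc => hc.1) ⟨b, hb, hwb⟩ ?_ (hsub w a ha).2).2 ha
    intro c hc a ha hac
    have hwa : E w a := by
      by_contra hn
      exact hac ⟨ha, hn⟩
    obtain ⟨hcomm, hiff⟩ := key a hwa c hc.1 hc.2
    have h1 : s a c = c := by
      rcases h.compl a c with e | e
      · exact absurd (hiff.1 e.1) hswz
      · exact e.1
    exact ⟨(h.fst_comm hcomm).symm.trans h1, h1⟩

/-- A closed tolerance relation on `B` which is not full. -/
structure IsProperTolerance (C : ∀ k, Set (Op D k)) (B : Set D) (θ : D → D → Prop) : Prop where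
  closed : PairClosed C θ
  sub : ∀ x y, θ x y → x ∈ B ∧ y ∈ B
  refl : ∀ x ∈ B, θ x x
  symm : ∀ x y, θ x y → θ y x
  proper : ¬ ∀ x ∈ B, ∀ y ∈ B, θ x y

/-- Closed relations compose. -/
lemma PairClosed.comp {F : D → D → Prop} (hE : PairClosed C E) (hF : PairClosed C F) :
    PairClosed C fun x z => ∃ y, E x y ∧ F y z where
  bin := fun hf _ _ _ _ ⟨_, h₁, h₂⟩ ⟨_, h₃, h₄⟩ => ⟨_, hE.bin hf h₁ h₃, hF.bin hf h₂ h₄⟩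
  ter := fun hf _ _ _ _ _ _ ⟨_, h₁, h₂⟩ ⟨_, h₃, h₄⟩ ⟨_, h₅, h₆⟩ =>
    ⟨_, hE.ter hf h₁ h₃ h₅, hF.ter hf h₂ h₄ h₆⟩

lemma PairClosed.swap (hE : PairClosed C E) : PairClosed C fun x y => E y x where
  bin := fun hf _ _ _ _ h₁ h₂ => hE.bin hf h₁ h₂
  ter := fun hf _ _ _ _ _ _ h₁ h₂ h₃ => hE.ter hf h₁ h₂ h₃

/-- On a set with at least two elements there is a maximal proper closed tolerance. -/
lemma exists_maximal_properTolerance [Finite D] (hC : IsConsClone C) (hB : B.Nontrivial) :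
    ∃ θ, Maximal (IsProperTolerance C B) θ := by
  refine Set.Finite.exists_maximal (Set.toFinite {θ | IsProperTolerance C B θ})
    ⟨fun x y => x ∈ B ∧ x = y, ⟨⟨?_, ?_⟩, ?_, ?_, ?_, ?_⟩⟩
  · rintro f hf x y _ _ ⟨hx, rfl⟩ ⟨hy, rfl⟩
    refine ⟨?_, rfl⟩
    rcases hf.eq_or hC x y with e | e <;> rw [e] <;> assumption
  · rintro f hf x y z _ _ _ ⟨hx, rfl⟩ ⟨hy, rfl⟩ ⟨hz, rfl⟩
    refine ⟨?_, rfl⟩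
    rcases hf.eq_or hC x y z with e | e | e <;> rw [e] <;> assumption
  · rintro x y ⟨hx, rfl⟩
    exact ⟨hx, hx⟩
  · exact fun x hx => ⟨hx, rfl⟩
  · rintro x y ⟨hx, rfl⟩
    exact ⟨hx, rfl⟩
  · intro hfull
    obtain ⟨x, hx, y, hy, hxy⟩ := hB
    exact hxy (hfull x hx y hy).2

/-- Maximal proper tolerances contain every proper tolerance extending them. -/
lemma le_of_maximal_properTolerance (hθ : Maximal (IsProperTolerance C B) θ)
    (hE : PairClosed C E) (hsub : ∀ x y, E x y → x ∈ B ∧ y ∈ B)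
    (hsymm : ∀ x y, E x y → E y x) (hle : ∀ x y, θ x y → E x y)
    (hfull : ¬ ∀ x ∈ B, ∀ y ∈ B, E x y) : ∀ x y, E x y → θ x y :=
  hθ.2 (y := E) ⟨hE, hsub, fun x hx => hle x x (hθ.1.refl x hx), hsymm, hfull⟩ hle

lemma trans_of_maximal_properTolerance [Finite D] (h : IsCyclicKit C s t d p m)
    (hB : AbsorptionFree s B) (hθ : Maximal (IsProperTolerance C B) θ) :
    ∀ x y z, θ x y → θ y z → θ x z := by
  have hp := hθ.1
  intro x y z hxy hyz
  refine le_of_maximal_properTolerance hθ (hp.closed.comp hp.closed) ?_ ?_ ?_ ?_ x z ⟨y, hxy, hyz⟩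
  · rintro x z ⟨y, hxy, hyz⟩
    exact ⟨(hp.sub x y hxy).1, (hp.sub y z hyz).2⟩
  · rintro x z ⟨y, hxy, hyz⟩
    exact ⟨y, hp.symm y z hyz, hp.symm x y hxy⟩
  · exact fun x y hxy => ⟨x, hp.refl x (hp.sub x y hxy).1, hxy⟩
  · intro hfull
    refine hp.proper (hp.closed.full h hB hp.sub (fun x hx => ⟨x, hp.refl x hx⟩) ?_)
    intro a ha b hb
    obtain ⟨x, h₁, h₂⟩ := hfull a ha b hb
    exact ⟨x, hp.symm a x h₁, h₂⟩

end Relations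

section Tuples

variable {D ι : Type} [AddCommGroup ι] {C : ∀ k, Set (Op D k)} {s t d : D → D → D}
  {p m : D → D → D → D} {B : Set D} {R : Set (ι → D)} {θ : D → D → Prop}

/-- A nonempty closed shift-invariant set of tuples, each of which has range exactly `B`. -/
structure IsSpread (C : ∀ k, Set (Op D k)) (B : Set D) (R : Set (ι → D)) : Prop where
  closed : TupleClosed C R
  nonempty : R.Nonempty
  shift : ∀ u ∈ R, ∀ v, (fun j => u (j + v)) ∈ R
  mem : ∀ u ∈ R, ∀ j, u j ∈ B
  hit : ∀ u ∈ R, ∀ x ∈ B, ∃ j, u j = x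

lemma IsSpread.absorptionFree [Finite ι] [Finite D] (h : IsSpread C B R)
    (hC : IsConsClone C) (hs : BinIn C s) : AbsorptionFree s B := by
  classical
  have := Fintype.ofFinite ι
  intro X hX ⟨x₀, hx₀⟩ habs y hy
  by_contra hyX
  obtain ⟨u, hu, hmax⟩ := Set.exists_max_image R
    (fun u => (Finset.univ.filter fun j => u j ∈ X).card) (Set.toFinite R) h.nonempty
  obtain ⟨j, hj⟩ := h.hit u hu x₀ (hX hx₀)
  obtain ⟨j', hj'⟩ := h.hit u hu y hy
  have hv := h.closed.bin hs hu (h.shift u hu (j - j'))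
  refine (hmax _ hv).not_gt (Finset.card_lt_card (Finset.ssubset_iff_of_subset ?_ |>.2
    ⟨j', ?_, ?_⟩))
  · intro i hi
    simp only [Finset.mem_filter, Finset.mem_univ, true_and] at hi ⊢
    by_cases hi' : u (i + (j - j')) ∈ X
    · rcases hs.eq_or hC (u i) (u (i + (j - j'))) with e | e <;> rw [e] <;> assumption
    · rw [(habs _ hi _ (h.mem u hu _) hi').1]
      exact hi
  · simp only [Finset.mem_filter, Finset.mem_univ, true_and, add_sub_cancel, hj, hj']
    rw [(habs _ hx₀ _ hy hyX).2]
    exact hx₀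
  · simpa [hj'] using hyX

/-- The pairs of values at distance `i` in tuples of `R`, up to `θ`. -/
def distRel (R : Set (ι → D)) (θ : D → D → Prop) (i : ι) (x y : D) : Prop :=
  ∃ u ∈ R, θ x (u 0) ∧ θ (u i) y

lemma IsSpread.distRel_closed (h : IsSpread C B R) (hθ : PairClosed C θ) (i : ι) :
    PairClosed C (distRel R θ i) where
  bin := fun hf _ _ _ _ ⟨_, hu, h₁, h₂⟩ ⟨_, hv, h₃, h₄⟩ =>
    ⟨_, h.closed.bin hf hu hv, hθ.bin hf h₁ h₃, hθ.bin hf h₂ h₄⟩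
  ter := fun hf _ _ _ _ _ _ ⟨_, hu, h₁, h₂⟩ ⟨_, hv, h₃, h₄⟩ ⟨_, hw, h₅, h₆⟩ =>
    ⟨_, h.closed.ter hf hu hv hw, hθ.ter hf h₁ h₃ h₅, hθ.ter hf h₂ h₄ h₆⟩

lemma IsSpread.exists_apply_eq (h : IsSpread C B R) {x : D} (hx : x ∈ B) (i : ι) :
    ∃ u ∈ R, u i = x := by
  obtain ⟨u, hu⟩ := h.nonempty
  obtain ⟨j, hj⟩ := h.hit u hu x hx
  exact ⟨_, h.shift u hu (j - i), by simpa using hj⟩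

/-- A closed equivalence relation compatible with a nonzero shift is full. -/
lemma IsSpread.full_of_compatible [Finite ι] [Finite D] (h : IsSpread C B R)
    (hcard : Nat.card D < Nat.card ι) (hgen : ∀ i : ι, i ≠ 0 → ∀ j, ∃ n : ℕ, n • i = j)
    (hrefl : ∀ x ∈ B, θ x x) (hsymm : ∀ x y, θ x y → θ y x)
    (htrans : ∀ x y z, θ x y → θ y z → θ x z) {i : ι} (hi : i ≠ 0)
    (hcomp : ∀ u ∈ R, ∀ v ∈ R, θ (u 0) (v 0) → θ (u i) (v i)) :
    ∀ x ∈ B, ∀ y ∈ B, θ x y := by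
  have hall : ∀ u ∈ R, ∀ v ∈ R, θ (u 0) (v 0) → ∀ j, θ (u j) (v j) := by
    intro u hu v hv h0 j
    obtain ⟨n, rfl⟩ := hgen i hi j
    induction n with
    | zero => simpa using h0
    | succ n ih =>
      have := hcomp _ (h.shift u hu (n • i)) _ (h.shift v hv (n • i)) (by simpa using ih)
      rwa [← succ_nsmul'] at this
  obtain ⟨u, hu⟩ := h.nonempty
  obtain ⟨j, k, hjk, huj⟩ : ∃ j k, j ≠ k ∧ u j = u k := by
    by_contra! hinj
    refine hcard.not_ge (Nat.card_le_card_of_injective u fun j k hjk => ?_)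
    by_contra hne
    exact hinj j k hne hjk
  have hstep : ∀ l, θ (u l) (u (l + (k - j))) := by
    intro l
    have := hall _ (h.shift u hu j) _ (h.shift u hu k)
      (by simpa [huj] using hrefl _ (h.mem u hu k)) (l - j)
    have e : l - j + k = l + (k - j) := by abel
    rwa [sub_add_cancel, e] at this
  have hclass : ∀ l, θ (u 0) (u l) := by
    intro l
    obtain ⟨n, rfl⟩ := hgen (k - j) (sub_ne_zero.2 hjk.symm) l
    induction n with
    | zero => simpa using hrefl _ (h.mem u hu 0)
    | succ n ih =>
      rw [succ_nsmul]
      exact htrans _ _ _ ih (hstep _)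
  intro x hx y hy
  obtain ⟨l, rfl⟩ := h.hit u hu x hx
  obtain ⟨l', rfl⟩ := h.hit u hu y hy
  exact htrans _ _ _ (hsymm _ _ (hclass l)) (hclass l')

/-- A closed tolerance relation for which all distance relations are full is full. -/
lemma IsSpread.full_of_distRel [Finite ι] [Nontrivial ι] (h : IsSpread C B R)
    (hm : IsCyclicKit C s t d p m) (hθ : PairClosed C θ)
    (hrefl : ∀ x ∈ B, θ x x) (hsymm : ∀ x y, θ x y → θ y x)
    (hdist : ∀ i : ι, i ≠ 0 → ∀ x ∈ B, ∀ y ∈ B, distRel R θ i x y) :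
    ∀ x ∈ B, ∀ y ∈ B, θ x y := by
  classical
  have := Fintype.ofFinite ι
  intro x hx y hy
  have hne : ∀ j k : ι, j ≠ k → ∃ u ∈ R, θ (u j) x ∧ θ (u k) x := by
    intro j k hjk
    obtain ⟨u, hu, h₁, h₂⟩ := hdist (k - j) (sub_ne_zero.2 hjk.symm) x hx x hx
    exact ⟨_, h.shift u hu (-j), by simpa using hsymm _ _ h₁, by simpa [sub_eq_add_neg] using h₂⟩
  have hpair : ∀ j ∈ (Finset.univ : Finset ι), ∀ k ∈ (Finset.univ : Finset ι),
      ({u | u ∈ R ∧ θ (u j) x} ∩ {u | u ∈ R ∧ θ (u k) x}).Nonempty := by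
    intro j _ k _
    by_cases hjk : j = k
    · subst hjk
      obtain ⟨k, hk⟩ := exists_ne j
      obtain ⟨u, hu, h₁, -⟩ := hne j k hk.symm
      exact ⟨u, ⟨hu, h₁⟩, hu, h₁⟩
    · obtain ⟨u, hu, h₁, h₂⟩ := hne j k hjk
      exact ⟨u, ⟨hu, h₁⟩, hu, h₂⟩
  obtain ⟨u, hu⟩ := exists_forall_mem_of_pairwise (A := R)
    (S := fun j : ι => {u | u ∈ R ∧ θ (u j) x}) (μ := fun u v w j => m (u j) (v j) (w j))
    (fun j u hu => hu.1)
    (fun j u hu v hv w hw => by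
      refine ⟨h.closed.ter hm.maj_in hu.1 hv.1 hw, ?_⟩
      have := hθ.ter hm.maj_in hu.2 hv.2 (hrefl _ (h.mem w hw j))
      rwa [hm.maj_aab] at this)
    (fun j u hu v hv w hw => by
      refine ⟨h.closed.ter hm.maj_in hu.1 hw hv.1, ?_⟩
      have := hθ.ter hm.maj_in hu.2 (hrefl _ (h.mem w hw j)) hv.2
      rwa [hm.maj_aba] at this)
    (fun j u hu v hv w hw => by
      refine ⟨h.closed.ter hm.maj_in hw hu.1 hv.1, ?_⟩
      have := hθ.ter hm.maj_in (hrefl _ (h.mem w hw j)) hu.2 hv.2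
      rwa [hm.maj_baa] at this)
    Finset.univ Finset.univ_nonempty hpair
  obtain ⟨l, rfl⟩ := h.hit u (hu 0 (Finset.mem_univ _)).1 y hy
  exact hsymm _ _ (hu l (Finset.mem_univ _)).2

lemma IsSpread.subsingleton [Finite ι] [Finite D] [Nontrivial ι] (h : IsSpread C B R)
    (hm : IsCyclicKit C s t d p m) (hcard : Nat.card D < Nat.card ι)
    (hgen : ∀ i : ι, i ≠ 0 → ∀ j, ∃ n : ℕ, n • i = j) : B.Subsingleton := by
  by_contra hB
  rw [Set.not_subsingleton_iff] at hB
  have habs := h.absorptionFree hm.cons hm.fst_in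
  obtain ⟨θ, hθ⟩ := exists_maximal_properTolerance hm.cons hB
  have hp := hθ.1
  have htrans := trans_of_maximal_properTolerance hm habs hθ
  refine hp.proper (h.full_of_distRel hm hp.closed hp.refl hp.symm fun i hi => ?_)
  have hE := h.distRel_closed hp.closed i
  have hsub : ∀ x a, distRel R θ i x a → x ∈ B ∧ a ∈ B := fun x a ⟨u, _, h₁, h₂⟩ =>
    ⟨(hp.sub _ _ h₁).1, (hp.sub _ _ h₂).2⟩
  refine hE.full hm habs hsub (fun x hx => ?_) ?_
  · obtain ⟨u, hu, rfl⟩ := h.exists_apply_eq hx 0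
    exact ⟨u i, u, hu, hp.refl _ hx, hp.refl _ (h.mem u hu i)⟩
  · by_contra! hlink
    have hlink' : ¬ ∀ a ∈ B, ∀ b ∈ B, ∃ x, distRel R θ i x a ∧ distRel R θ i x b := by
      simpa using hlink
    have hle := le_of_maximal_properTolerance hθ (hE.swap.comp hE) ?_ ?_ ?_ hlink'
    · refine hp.proper (h.full_of_compatible hcard hgen hp.refl hp.symm htrans hi ?_)
      intro u hu v hv huv
      exact hle _ _ ⟨u 0, ⟨u, hu, hp.refl _ (h.mem u hu 0), hp.refl _ (h.mem u hu i)⟩,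
        v, hv, huv, hp.refl _ (h.mem v hv i)⟩
    · rintro a b ⟨x, h₁, h₂⟩
      exact ⟨(hsub _ _ h₁).2, (hsub _ _ h₂).2⟩
    · rintro a b ⟨x, h₁, h₂⟩
      exact ⟨x, h₂, h₁⟩
    · intro a b hab
      obtain ⟨u, hu, rfl⟩ := h.exists_apply_eq (hp.sub _ _ hab).1 i
      have h0 := hp.refl _ (h.mem u hu 0)
      exact ⟨u 0, ⟨u, hu, h0, hp.refl _ (h.mem u hu i)⟩, u, hu, h0, hab⟩

/-- Closed shift-invariant sets of tuples of prime length contain a constant tuple. -/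
lemma exists_const_mem [Finite ι] [Finite D] [Nontrivial ι]
    (hm : IsCyclicKit C s t d p m) (hcard : Nat.card D < Nat.card ι)
    (hgen : ∀ i : ι, i ≠ 0 → ∀ j, ∃ n : ℕ, n • i = j) (hR : TupleClosed C R)
    (hne : R.Nonempty) (hshift : ∀ u ∈ R, ∀ v, (fun j => u (j + v)) ∈ R) :
    ∃ c, (fun _ => c) ∈ R := by
  obtain ⟨u, hu, hmin⟩ := Set.exists_min_image R (fun u => (Set.range u).ncard)
    (Set.toFinite R) hne
  have hspread : IsSpread C (Set.range u) {v | v ∈ R ∧ ∀ j, v j ∈ Set.range u} := by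
    refine ⟨⟨?_, ?_⟩, ⟨u, hu, fun j => ⟨j, rfl⟩⟩, ?_, fun v hv => hv.2, ?_⟩
    · rintro f hf v w ⟨hv, hv'⟩ ⟨hw, hw'⟩
      refine ⟨hR.bin hf hv hw, fun j => ?_⟩
      rcases hf.eq_or hm.cons (v j) (w j) with e | e <;> simp only [e, hv', hw']
    · rintro f hf v w z ⟨hv, hv'⟩ ⟨hw, hw'⟩ ⟨hz, hz'⟩
      refine ⟨hR.ter hf hv hw hz, fun j => ?_⟩
      rcases hf.eq_or hm.cons (v j) (w j) (z j) with e | e | e <;> simp only [e, hv', hw', hz']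
    · exact fun v hv l => ⟨hshift v hv.1 l, fun j => hv.2 _⟩
    · intro v hv x hx
      have hsub : Set.range v ⊆ Set.range u := Set.range_subset_iff.2 hv.2
      rw [← Set.eq_of_subset_of_ncard_le hsub (hmin v hv.1)] at hx
      exact hx
  have hsub := hspread.subsingleton hm hcard hgen
  refine ⟨u 0, ?_⟩
  have : (fun _ => u 0) = u := funext fun j => hsub ⟨0, rfl⟩ ⟨j, rfl⟩
  rwa [this]

end Tuples

/-! ### Constructing a cyclic operation -/

section Backward

lemma ZMod.exists_nsmul_eq {q : ℕ} [Fact q.Prime] {i : ZMod q} (hi : i ≠ 0) (j : ZMod q) :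
    ∃ n : ℕ, n • i = j :=
  ⟨(j * i⁻¹).val, by rw [nsmul_eq_mul, ZMod.natCast_zmod_val, mul_assoc, inv_mul_cancel₀ hi, mul_one]⟩

variable {D : Type} {C : ∀ k, Set (Op D k)} {s t d : D → D → D} {p m : D → D → D → D}

/-- The relation generated by the shifts of a tuple is closed. -/
lemma tupleClosed_shifts (hC : IsClone C) {n : ℕ} (u : Fin (n + 1) → D) :
    TupleClosed C {v : Fin (n + 1) → D | ∃ h ∈ C (n + 1), v = fun j => h fun i => u (i + j)} where
  bin := by
    rintro f hf _ _ ⟨g, hg, rfl⟩ ⟨h, hh, rfl⟩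
    exact ⟨_, hC.comp2 hf hg hh, rfl⟩
  ter := by
    rintro f hf _ _ _ ⟨g, hg, rfl⟩ ⟨h, hh, rfl⟩ ⟨l, hl, rfl⟩
    exact ⟨_, hC.comp3 hf hg hh hl, rfl⟩

lemma IsCyclicKit.exists_const_shifts [Finite D] (hm : IsCyclicKit C s t d p m) {n : ℕ}
    (hprime : (n + 1).Prime) (hcard : Nat.card D < n + 1) (u : Fin (n + 1) → D) :
    ∃ h ∈ C (n + 1), ∃ c, ∀ j, (h fun i => u (i + j)) = c := by
  have : Fact (n + 1).Prime := ⟨hprime⟩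
  have : Nontrivial (Fin (n + 1)) := inferInstanceAs (Nontrivial (ZMod (n + 1)))
  obtain ⟨c, h, hh, hc⟩ := exists_const_mem (ι := Fin (n + 1)) hm (by simpa using hcard)
    (fun i hi j => ZMod.exists_nsmul_eq (q := n + 1) hi j)
    (tupleClosed_shifts hm.cons.toIsClone u) ⟨_, _, hm.cons.pr 0, rfl⟩ (by
      rintro _ ⟨h, hh, rfl⟩ v
      refine ⟨_, hm.cons.minor_mem hh (fun i => i + v), funext fun j => ?_⟩
      simp only [add_assoc, add_comm j v])
  exact ⟨h, hh, c, fun j => (congrFun hc j).symm⟩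

/-- A clone containing a cyclic kit has cyclic operations of all large prime arities. -/
lemma IsCyclicKit.exists_cyclic [Finite D] (hm : IsCyclicKit C s t d p m) {n : ℕ}
    (hprime : (n + 1).Prime) (hcard : Nat.card D < n + 1) :
    ∃ f ∈ C (n + 1), CyclicOp f := by
  classical
  have := Fintype.ofFinite D
  let good : Op D (n + 1) → (Fin (n + 1) → D) → Prop := fun f u =>
    ∀ v, (f fun i => u (i + v)) = f u
  obtain ⟨f, hf, hmax⟩ := Set.exists_max_image (C (n + 1))
    (fun f => (Finset.univ.filter fun u => good f u).card) (Set.toFinite _) ⟨_, hm.cons.pr 0⟩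
  refine ⟨f, hf, ?_⟩
  by_cases hgood : ∀ u, good f u
  · intro u
    rw [← hgood u 1]
    simp only [Function.comp_def, finRotate_apply]
  push Not at hgood
  obtain ⟨u, hu⟩ := hgood
  obtain ⟨h, hh, c, hc⟩ := hm.exists_const_shifts hprime hcard fun j => f fun i => u (i + j)
  have hidem : ∀ e, (h fun _ => e) = e := by
    intro e
    obtain ⟨i, hi⟩ := hm.cons.conservative _ h hh fun _ => e
    exact hi
  let f' : Op D (n + 1) := fun x => h fun j => f fun i => x (i + j)
  have hf' : f' ∈ C (n + 1) := hm.cons.superpose_mem _ _ h (fun j x => f fun i => x (i + j)) hh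
    fun j => hm.cons.minor_mem hf fun i => i + j
  have hconst : ∀ v, (f' fun i => u (i + v)) = c := by
    intro v
    rw [← hc v]
    simp only [f', add_assoc]
  refine absurd (hmax f' hf') (Finset.card_lt_card (Finset.ssubset_iff_of_subset ?_ |>.2
    ⟨u, ?_, ?_⟩)).not_ge
  · intro w hw
    simp only [Finset.mem_filter, Finset.mem_univ, true_and] at hw ⊢
    have key : ∀ v, (f' fun i => w (i + v)) = f w := by
      intro v
      rw [← hidem (f w)]
      simp only [f']
      congr 1
      funext j
      rw [← hw (j + v)]
      simp only [add_assoc]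
    intro v
    have h0 := key 0
    simp only [add_zero] at h0
    rw [key v, h0]
  · simp only [Finset.mem_filter, Finset.mem_univ, true_and]
    intro v
    have h0 := hconst 0
    simp only [add_zero] at h0
    rw [hconst v, h0]
  · simpa using hu

/-- The median built from a pair of complementary operations. -/
def joinMedian (s t : D → D → D) (x y z : D) : D := t (t (s x y) (s y z)) (s x z)

lemma joinMedian_majority {a b : D} (hs : s a b = s b a) (hsa : s a a = a)
    (hta : t a a = a) (htb : t b b = b) (h₁ : (s a b = a ∧ t a b = b) ∨ (s a b = b ∧ t a b = a))
    (h₂ : (s b a = b ∧ t b a = a) ∨ (s b a = a ∧ t b a = b)) :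
    joinMedian s t a a b = a ∧ joinMedian s t a b a = a ∧ joinMedian s t b a a = a := by
  unfold joinMedian
  grind

variable [Fintype D] [DecidableEq D] {Γ : VLang D}

lemma exists_cyclicKit (hcons : ConservativeLang Γ) {mj mn : D → D → D → D}
    (hmj : TerIn (PolPlus Γ) mj) (hmn : TerIn (PolPlus Γ) mn)
    (hmaj : ∀ x y, ProjPair (PolPlus Γ) x y → mj x x y = x ∧ mj x y x = x ∧ mj y x x = x)
    (hmin : ∀ x y, ProjPair (PolPlus Γ) x y → mn x x y = y ∧ mn x y x = y ∧ mn y x x = y) :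
    ∃ s t d p m, IsCyclicKit (PolPlus Γ) s t d p m := by
  have hC := isConsClone_polPlus hcons
  obtain ⟨s, hs, hcomm, hleft⟩ := exists_commutative_or_left hC
  have hs2 := (binIn_compl2 hcons hs).1
  have h0 := hC.pr (k := 3) 0
  have h1 := hC.pr (k := 3) 1
  have h2 := hC.pr (k := 3) 2
  have hkit := isToolkit_of_pixley hcons hs hcomm hleft (p := fun x y z => mn x (mj x y z) z)
    (hC.comp3 hmn h0 hmj h2) fun a b hab => by
      have e := hmin a b hab
      have e' := hmin b a hab.symm
      have e'' := hmaj a b hab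
      have e3 := hmaj b a hab.symm
      have e4 := hmn.idem hC a
      simp only [e'', e3, e, e', e4, and_self]
  have htm : TerIn (PolPlus Γ) (joinMedian s (compl2 s)) := by
    unfold TerIn joinMedian
    exact hC.comp2 hs2 (hC.comp2 hs2 (hC.comp2 hs h0 h1) (hC.comp2 hs h1 h2)) (hC.comp2 hs h0 h2)
  have key : ∀ a b, ∀ l : Fin 3 → D, (∀ i, l i = a ∨ l i = b) →
      (CommPair (PolPlus Γ) a b → joinMedian s (compl2 s) (l 0) (l 1) (l 2) = a) →
      (ProjPair (PolPlus Γ) a b → mj (l 0) (l 1) (l 2) = a) →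
      compl2 s (joinMedian s (compl2 s) (l 0) (l 1) (l 2))
        (s (mj (l 0) (l 1) (l 2)) (joinMedian s (compl2 s) (l 0) (l 1) (l 2))) = a := by
    intro a b l hl hc hp
    have e₁ : joinMedian s (compl2 s) (l 0) (l 1) (l 2) = a ∨
        joinMedian s (compl2 s) (l 0) (l 1) (l 2) = b := by
      rcases htm.eq_or hC (l 0) (l 1) (l 2) with e | e | e <;> rw [e] <;> exact hl _
    have e₂ : mj (l 0) (l 1) (l 2) = a ∨ mj (l 0) (l 1) (l 2) = b := by
      rcases hmj.eq_or hC (l 0) (l 1) (l 2) with e | e | e <;> rw [e] <;> exact hl _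
    have e₃ := hkit.d_idem hC a
    by_cases hab : a = b
    · subst hab
      rw [(or_self_iff).1 e₁, (or_self_iff).1 e₂]
      exact e₃
    rcases commPair_or_projPair (C := PolPlus Γ) hab with h | h
    · rw [hc h]
      rcases e₂ with e | e <;> rw [e]
      exacts [e₃, hkit.comm h]
    · rw [hp h]
      rcases e₁ with e | e <;> rw [e]
      exacts [e₃, hkit.proj h.symm]
  have hmed : ∀ a b, CommPair (PolPlus Γ) a b → _ := fun a b h =>
    joinMedian_majority (hcomm a b h) (hs.idem hC a) (hs2.idem hC a) (hs2.idem hC b)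
      (compl2_cases (hs.eq_or hC) a b) (compl2_cases (hs.eq_or hC) b a)
  refine ⟨s, compl2 s, _, _, fun x y z => compl2 s (joinMedian s (compl2 s) x y z)
    (s (mj x y z) (joinMedian s (compl2 s) x y z)), hkit, hC, hs, hs2, fun h => hcomm _ _ h,
    compl2_cases (hs.eq_or hC), hC.comp2 hs2 htm (hC.comp2 hs hmj htm), ?_, ?_, ?_⟩
  · exact fun a b => key a b ![a, a, b] (by simp [Fin.forall_fin_succ])
      (fun h => (hmed a b h).1) fun h => (hmaj a b h).1
  · exact fun a b => key a b ![a, b, a] (by simp [Fin.forall_fin_succ])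
      (fun h => (hmed a b h).2.1) fun h => (hmaj a b h).2.1
  · exact fun a b => key a b ![b, a, a] (by simp [Fin.forall_fin_succ])
      (fun h => (hmed a b h).2.2) fun h => (hmaj a b h).2.2

end Backward

/-- For a conservative language `Γ`, the positive clone contains an
idempotent cyclic operation iff `Γ` admits a conservative binary multimorphism `⟨⊓,⊔⟩` and a
conservative ternary multimorphism `⟨Mj₁,Mj₂,Mn₃⟩` together with a family `M` of two-element
subsets of `D` such that on pairs in `M` the binary multimorphism is an STP and on pairs not
in `M` the ternary one is an MJN. -/
theorem conservative_cyclic_iff_STP_MJN {D : Type} [Fintype D] [DecidableEq D] [Nonempty D]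
    (Γ : VLang D) (hcons : ConservativeLang Γ) :
    (∃ k : ℕ, 1 < k ∧ ∃ f ∈ PolPlus Γ k, Idem f ∧ CyclicOp f) ↔
      ∃ (meet join : Op D 2) (mj₁ mj₂ mn₃ : Op D 3) (M : Set (Set D)),
        Conservative meet ∧ Conservative join ∧
        Conservative mj₁ ∧ Conservative mj₂ ∧ Conservative mn₃ ∧
        AdmitsMultimorphism Γ ![meet, join] ∧
        AdmitsMultimorphism Γ ![mj₁, mj₂, mn₃] ∧
        (∀ S ∈ M, ∃ x y : D, x ≠ y ∧ S = {x, y}) ∧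
        (∀ x y : D, x ≠ y → ({x, y} : Set D) ∈ M →
          ∀ a ∈ ({x, y} : Set D), ∀ b ∈ ({x, y} : Set D),
            ap2 meet a b = ap2 meet b a ∧ ap2 join a b = ap2 join b a ∧
            (a ≠ b → ap2 meet a b ≠ ap2 join a b)) ∧
        (∀ x y : D, x ≠ y → ({x, y} : Set D) ∉ M →
          IsMajorityOn mj₁ {x, y} ∧ IsMajorityOn mj₂ {x, y} ∧ IsMinorityOn mn₃ {x, y}) := by
  have hC := isConsClone_polPlus hcons
  constructor
  · rintro ⟨k, hk, f, hf, -, hcyc⟩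
    exact exists_multimorphisms_of_cyclic hcons hk hf hcyc
  · rintro ⟨meet, join, mj₁, mj₂, mn₃, M, -, -, -, -, -, hmj, hmjn, -, hM, hM'⟩
    have hmeet := binIn_of_mem (hmj.mem_polPlus 0)
    have h₁ := terIn_of_mem (hmjn.mem_polPlus 0)
    have h₃ := terIn_of_mem (hmjn.mem_polPlus 2)
    have hpair : ∀ x y, ProjPair (PolPlus Γ) x y → ({x, y} : Set D) ∉ M := fun x y h hxy =>
      h.2 _ hmeet (hM x y h.1 hxy x (by simp) y (by simp)).1
    obtain ⟨s, t, d, p, m, hkit⟩ := exists_cyclicKit hcons h₁ h₃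
      (fun x y h => (hM' x y h.1 (hpair x y h)).1 x (by simp) y (by simp))
      (fun x y h => (hM' x y h.1 (hpair x y h)).2.2 x (by simp) y (by simp))
    obtain ⟨q, hq, hprime⟩ := Nat.exists_infinite_primes (Nat.card D + 1)
    obtain ⟨n, rfl⟩ : ∃ n, q = n + 1 := ⟨q - 1, by omega⟩
    obtain ⟨f, hf, hcyc⟩ := hkit.exists_cyclic hprime hq
    refine ⟨n + 1, hprime.one_lt, f, hf, fun x => ?_, hcyc⟩
    obtain ⟨i, hi⟩ := hC.conservative _ f hf fun _ => x
    exact hi
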